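/- arXiv:math/0011251 — 2 statements merged into one kernel-verified Lean document; each statement's English description precedes it below -/
import Mathlib

section
/- If R is a standard bigraded Koszul K-algebra, then every diagonal subalgebra R_Δ = ⊕_{i≥0} R_{(ia,ib)} (for (a,b) ≠ (0,0)) is a Koszul algebra, i.e., reg_{R_Δ} K = 0. -/
/-- The `j`-th graded component of the graded free module `σ →₀ A` with basis
elements of degrees `deg`. -/
def freeGrading {K A ι : Type} [Field K] [CommRing A] [Algebra K A] [AddCommGroup ι]
    (𝒜 : ι → Submodule K A) {σ : Type} (deg : σ → ι) (j : ι) : Submodule K (σ →₀ A) where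
  carrier := {f | ∀ s, f s ∈ 𝒜 (j - deg s)}
  add_mem' := fun {f g} hf hg s => by
    rw [Finsupp.add_apply]; exact add_mem (hf s) (hg s)
  zero_mem' := fun s => by simp
  smul_mem' := fun c f hf s => by
    rw [Finsupp.smul_apply]; exact Submodule.smul_mem _ c (hf s)

/-- A map of graded modules has degree `0`. -/
def IsGradedMap {K A ι M N : Type} [Field K] [CommRing A] [Algebra K A] [AddCommGroup ι]
    [AddCommGroup M] [Module A M] [AddCommGroup N] [Module A N]
    [Module K M] [Module K N]
    (ℳ : ι → Submodule K M) (𝒩 : ι → Submodule K N) (φ : M →ₗ[A] N) : Prop :=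
  ∀ j : ι, ∀ x ∈ ℳ j, φ x ∈ 𝒩 j

/-- A graded free resolution of the graded module `(M, ℳ)` over the graded algebra
`(A, 𝒜)`, in which the `s`-th free module has basis elements of degrees lying in
the prescribed set `D s`.  The existence of such a resolution with
`D s = {j | j ≤ b s}` is equivalent to the vanishing `Tor_s^A(M, K)_j = 0` for all
`j > b s`, i.e. to `t_s(M) ≤ b s` (for all `s` simultaneously). -/
structure GradedFreeResolution (K A : Type) [Field K] [CommRing A] [Algebra K A]
    {ι : Type} [AddCommGroup ι] (𝒜 : ι → Submodule K A)
    (M : Type) [AddCommGroup M] [Module A M] [Module K M]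
    (ℳ : ι → Submodule K M) (D : ℕ → Set ι) where
  σ : ℕ → Type
  deg : (s : ℕ) → σ s → ι
  deg_mem : ∀ (s : ℕ) (i : σ s), deg s i ∈ D s
  aug : (σ 0 →₀ A) →ₗ[A] M
  d : (s : ℕ) → ((σ (s+1) →₀ A) →ₗ[A] (σ s →₀ A))
  aug_surjective : Function.Surjective aug
  aug_graded : IsGradedMap (K := K) (freeGrading 𝒜 (deg 0)) ℳ aug
  d_graded : ∀ s : ℕ,
    IsGradedMap (K := K) (freeGrading 𝒜 (deg (s+1))) (freeGrading 𝒜 (deg s)) (d s)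
  exact_zero : LinearMap.range (d 0) = LinearMap.ker aug
  exact_succ : ∀ s : ℕ, LinearMap.range (d (s+1)) = LinearMap.ker (d s)

/-- The irrelevant ideal of a graded algebra. -/
def irrelevant {K B ι : Type} [Field K] [CommRing B] [Algebra K B] [AddCommGroup ι]
    (ℬ : ι → Submodule K B) : Ideal B :=
  Ideal.span {x | ∃ i : ι, i ≠ 0 ∧ x ∈ ℬ i}

/-- The grading of the residue field `B ⧸ B₊`, concentrated in degree `0`. -/
def residueGrading (K B : Type) [Field K] [CommRing B] [Algebra K B] {ι : Type}
    [AddCommGroup ι] [DecidableEq ι] (ℬ : ι → Submodule K B) :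
    ι → Submodule K (B ⧸ irrelevant ℬ) :=
  fun i => if i = 0 then ⊤ else ⊥

/-- A positively `ℤ`-graded `K`-algebra is Koszul if the residue field has a linear
graded free resolution. -/
def IsKoszul (K B : Type) [Field K] [CommRing B] [Algebra K B]
    (ℬ : ℤ → Submodule K B) : Prop :=
  Nonempty (GradedFreeResolution K B ℬ (B ⧸ irrelevant ℬ) (residueGrading K B ℬ)
    (fun s => {(s : ℤ)}))

/-- A (positively) bigraded `K`-algebra is Koszul if the residue field has a free
resolution which is linear in the total degree. -/
def IsKoszulBi (K B : Type) [Field K] [CommRing B] [Algebra K B]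
    (ℬ : ℤ × ℤ → Submodule K B) : Prop :=
  Nonempty (GradedFreeResolution K B ℬ (B ⧸ irrelevant ℬ) (residueGrading K B ℬ)
    (fun s => {v : ℤ × ℤ | v.1 + v.2 = (s : ℤ)}))

/-- A bigraded algebra is standard if it is positively graded and generated by its
components of degrees `(1,0)` and `(0,1)` over the degree-`(0,0)` part `K`. -/
def IsStandardBigraded (K R : Type) [Field K] [CommRing R] [Algebra K R]
    (ℛ : ℤ × ℤ → Submodule K R) : Prop :=
  (∀ p : ℤ × ℤ, p.1 < 0 ∨ p.2 < 0 → ℛ p = ⊥) ∧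
  (ℛ (0, 0) = 1) ∧
  (∀ p : ℤ × ℤ, 0 ≤ p.1 → 0 ≤ p.2 →
    ℛ p = ℛ (1, 0) ^ p.1.toNat * ℛ (0, 1) ^ p.2.toNat)

/-- A `ℤ`-graded `K`-algebra is standard if it is positively graded, `𝒜 0 = K`, and
it is generated in degree `1`. -/
def IsStandardGraded (K A : Type) [Field K] [CommRing A] [Algebra K A]
    (𝒜 : ℤ → Submodule K A) : Prop :=
  (∀ i : ℤ, i < 0 → 𝒜 i = ⊥) ∧ (𝒜 0 = 1) ∧ (∀ n : ℕ, 𝒜 (n : ℤ) = 𝒜 1 ^ n)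

set_option linter.unusedSectionVars false

section GradedModules

variable {K A ι : Type} [Field K] [CommRing A] [Algebra K A] [AddCommGroup ι]

/-- Compatibility of a family of subspaces of an `A`-module with the grading of `A`. -/
def GradedCompat {M : Type} [AddCommGroup M] [Module A M] [Module K M]
    (𝒜 : ι → Submodule K A) (ℳ : ι → Submodule K M) : Prop :=
  ∀ (p q : ι) (a : A) (m : M), a ∈ 𝒜 p → m ∈ ℳ q → a • m ∈ ℳ (p + q)

/-- The graded pieces of `⨁ₜ M(-deg t)`. -/
def shiftGrading {M τ : Type} [AddCommGroup M] [Module K M]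
    (ℳ : ι → Submodule K M) (deg : τ → ι) (j : ι) : Submodule K (τ →₀ M) where
  carrier := {f | ∀ t, f t ∈ ℳ (j - deg t)}
  add_mem' := fun {f g} hf hg t => by
    rw [Finsupp.add_apply]; exact add_mem (hf t) (hg t)
  zero_mem' := fun t => by simp
  smul_mem' := fun c f hf t => by
    rw [Finsupp.smul_apply]; exact Submodule.smul_mem _ c (hf t)

/-- The graded pieces of a direct sum of graded modules with a common ambient module. -/
def sumGrading {N κ : Type} [AddCommGroup N] [Module K N]
    (𝒩 : κ → ι → Submodule K N) (j : ι) : Submodule K (κ →₀ N) where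
  carrier := {f | ∀ k, f k ∈ 𝒩 k j}
  add_mem' := fun {f g} hf hg t => by
    rw [Finsupp.add_apply]; exact add_mem (hf t) (hg t)
  zero_mem' := fun t => by simp
  smul_mem' := fun c f hf t => by
    rw [Finsupp.smul_apply]; exact Submodule.smul_mem _ c (hf t)

/-- The graded pieces of the kernel of a linear map. -/
def kerGrading {M N : Type} [AddCommGroup M] [Module A M] [Module K M] [IsScalarTower K A M]
    [AddCommGroup N] [Module A N] (ℳ : ι → Submodule K M) (g : M →ₗ[A] N) (j : ι) :
    Submodule K M :=
  ℳ j ⊓ (LinearMap.ker g).restrictScalars K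

theorem mem_kerGrading {M N : Type} [AddCommGroup M] [Module A M] [Module K M]
    [IsScalarTower K A M] [AddCommGroup N] [Module A N] {ℳ : ι → Submodule K M}
    {g : M →ₗ[A] N} {j : ι} {m : M} : m ∈ kerGrading ℳ g j ↔ m ∈ ℳ j ∧ g m = 0 := by
  simp [kerGrading]

theorem GradedCompat.ker {M N : Type} [AddCommGroup M] [Module A M] [Module K M]
    [IsScalarTower K A M] [AddCommGroup N] [Module A N] {𝒜 : ι → Submodule K A}
    {ℳ : ι → Submodule K M} (h : GradedCompat 𝒜 ℳ) (g : M →ₗ[A] N) :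
    GradedCompat 𝒜 (kerGrading ℳ g) := by
  intro p q a m ha hm
  rw [mem_kerGrading] at hm ⊢
  exact ⟨h p q a m ha hm.1, by rw [map_smul, hm.2, smul_zero]⟩

theorem gradedCompat_self (𝒜 : ι → Submodule K A) [SetLike.GradedMonoid 𝒜] :
    GradedCompat 𝒜 𝒜 := fun _ _ _ _ ha hm => SetLike.mul_mem_graded ha hm

theorem GradedCompat.sum {N κ : Type} [AddCommGroup N] [Module A N] [Module K N]
    {𝒜 : ι → Submodule K A} {𝒩 : κ → ι → Submodule K N} (h : ∀ k, GradedCompat 𝒜 (𝒩 k)) :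
    GradedCompat 𝒜 (sumGrading 𝒩) :=
  fun p q a m ha hm k => h k p q a (m k) ha (hm k)

theorem GradedCompat.shift {M : Type} [AddCommGroup M] [Module A M] [Module K M]
    {𝒜 : ι → Submodule K A} {ℳ : ι → Submodule K M} (h : GradedCompat 𝒜 ℳ) (c : ι) :
    GradedCompat 𝒜 (fun j => ℳ (j - c)) := by
  intro p q a m ha hm
  have := h p (q - c) a m ha hm
  rwa [← add_sub_assoc] at this

theorem gradedCompat_free (𝒜 : ι → Submodule K A) [SetLike.GradedMonoid 𝒜] {σ : Type}
    (deg : σ → ι) : GradedCompat 𝒜 (freeGrading 𝒜 deg) :=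
  GradedCompat.sum (fun k => (gradedCompat_self 𝒜).shift (deg k))

/-- The image in `σ →₀ M` of `f ⊗ m`, for `f : σ →₀ A` and `m : M`. -/
noncomputable def outer (M : Type) [AddCommGroup M] [Module A M] (σ : Type) :
    (σ →₀ A) →ₗ[A] M →ₗ[A] (σ →₀ M) :=
  Finsupp.linearCombination A (fun s => (Finsupp.lsingle s : M →ₗ[A] (σ →₀ M)))

theorem outer_single {M : Type} [AddCommGroup M] [Module A M] {σ : Type} (s : σ) (a : A)
    (m : M) : outer M σ (Finsupp.single s a) m = Finsupp.single s (a • m) := by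
  simp [outer]

theorem outer_apply {M : Type} [AddCommGroup M] [Module A M] {σ : Type} (f : σ →₀ A)
    (m : M) (s : σ) : outer M σ f m s = f s • m := by
  classical
  induction f using Finsupp.induction_linear with
  | zero => simp
  | add f g hf hg => simp [hf, hg, add_smul]
  | single t a =>
    rw [outer_single]
    by_cases h : t = s
    · subst h; simp
    · simp [Finsupp.single_eq_of_ne' h]

/-- The map `M ⊗ d : M ⊗ A^(τ) → M ⊗ A^(σ)`, in terms of finitely supported functions. -/
noncomputable def tens (M : Type) [AddCommGroup M] [Module A M] {τ σ : Type}
    (d : (τ →₀ A) →ₗ[A] (σ →₀ A)) : (τ →₀ M) →ₗ[A] (σ →₀ M) :=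
  Finsupp.lsum ℕ (fun t => outer M σ (d (Finsupp.single t 1)))

theorem tens_single {M : Type} [AddCommGroup M] [Module A M] {τ σ : Type}
    (d : (τ →₀ A) →ₗ[A] (σ →₀ A)) (t : τ) (m : M) :
    tens M d (Finsupp.single t m) = outer M σ (d (Finsupp.single t 1)) m := by
  simp [tens]

theorem tens_outer {M : Type} [AddCommGroup M] [Module A M] {τ σ : Type}
    (d : (τ →₀ A) →ₗ[A] (σ →₀ A)) (f : τ →₀ A) (m : M) :
    tens M d (outer M τ f m) = outer M σ (d f) m := by
  induction f using Finsupp.induction_linear with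
  | zero => simp
  | add f g hf hg => simp [hf, hg]
  | single t a =>
    rw [outer_single, tens_single, map_smul, ← LinearMap.smul_apply, ← map_smul, ← map_smul,
      Finsupp.smul_single, smul_eq_mul, mul_one]

theorem tens_tens {M : Type} [AddCommGroup M] [Module A M] {τ σ ρ : Type}
    (d : (τ →₀ A) →ₗ[A] (σ →₀ A)) (d' : (ρ →₀ A) →ₗ[A] (τ →₀ A)) (x : ρ →₀ M) :
    tens M d (tens M d' x) = tens M (d ∘ₗ d') x := by
  induction x using Finsupp.induction_linear with
  | zero => simp
  | add f g hf hg => simp [hf, hg]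
  | single t a => rw [tens_single, tens_outer, tens_single]; rfl

theorem tens_zero {M : Type} [AddCommGroup M] [Module A M] {τ σ : Type} (x : τ →₀ M) :
    tens M (0 : (τ →₀ A) →ₗ[A] (σ →₀ A)) x = 0 := by
  induction x using Finsupp.induction_linear with
  | zero => simp
  | add f g hf hg => simp [hf, hg]
  | single t a => rw [tens_single]; simp

theorem tens_self {τ σ : Type} (d : (τ →₀ A) →ₗ[A] (σ →₀ A)) (x : τ →₀ A) :
    tens A d x = d x := by
  induction x using Finsupp.induction_linear with
  | zero => simp
  | add f g hf hg => simp [hf, hg]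
  | single t a =>
    rw [tens_single]
    ext s
    rw [outer_apply, show Finsupp.single t a = a • Finsupp.single t (1 : A) by simp, map_smul,
      Finsupp.smul_apply, smul_eq_mul, smul_eq_mul, mul_comm]

theorem mapRange_tens {M N : Type} [AddCommGroup M] [Module A M] [AddCommGroup N] [Module A N]
    (g : M →ₗ[A] N) {τ σ : Type} (d : (τ →₀ A) →ₗ[A] (σ →₀ A)) (x : τ →₀ M) :
    Finsupp.mapRange.linearMap g (tens M d x) = tens N d (Finsupp.mapRange.linearMap g x) := by
  induction x using Finsupp.induction_linear with
  | zero => simp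
  | add f h hf hh => simp only [map_add, hf, hh]
  | single t a =>
    ext s
    simp [tens_single, outer_apply]

theorem tens_mem_shiftGrading {M : Type} [AddCommGroup M] [Module A M] [Module K M]
    {𝒜 : ι → Submodule K A} {ℳ : ι → Submodule K M} (hM : GradedCompat 𝒜 ℳ)
    {τ σ : Type} {deg : τ → ι} {deg' : σ → ι} {d : (τ →₀ A) →ₗ[A] (σ →₀ A)}
    (hd : ∀ t, d (Finsupp.single t 1) ∈ freeGrading 𝒜 deg' (deg t))
    {j : ι} {x : τ →₀ M} (hx : x ∈ shiftGrading ℳ deg j) :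
    tens M d x ∈ shiftGrading ℳ deg' j := by
  intro s
  rw [tens, Finsupp.lsum_apply, Finsupp.sum, Finsupp.finsetSum_apply]
  refine sum_mem fun t _ => ?_
  rw [outer_apply]
  have := hM _ _ _ _ (hd t s) (hx t)
  rwa [show deg t - deg' s + (j - deg t) = j - deg' s by abel] at this

theorem single_mem_freeGrading {𝒜 : ι → Submodule K A} [SetLike.GradedOne 𝒜] {σ : Type}
    (deg : σ → ι) (s : σ) : Finsupp.single s (1 : A) ∈ freeGrading 𝒜 deg (deg s) := by
  classical
  intro t
  by_cases h : s = t
  · subst h; simpa using SetLike.GradedOne.one_mem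
  · simp [Finsupp.single_eq_of_ne' h]

theorem linearCombination_mem {M : Type} [AddCommGroup M] [Module A M] [Module K M]
    {𝒜 : ι → Submodule K A} {ℳ : ι → Submodule K M} (hM : GradedCompat 𝒜 ℳ)
    {τ : Type} {deg : τ → ι} {g : τ → M} (hg : ∀ t, g t ∈ ℳ (deg t)) {j : ι} {x : τ →₀ A}
    (hx : x ∈ freeGrading 𝒜 deg j) : Finsupp.linearCombination A g x ∈ ℳ j := by
  rw [Finsupp.linearCombination_apply, Finsupp.sum]
  refine sum_mem fun t _ => ?_
  have := hM _ _ _ _ (hx t) (hg t)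
  rwa [sub_add_cancel] at this

/-- A sequence of free graded modules resolving `(M, ℳ)` in each degree. -/
structure HomogeneousResolution (𝒜 : ι → Submodule K A)
    (M : Type) [AddCommGroup M] [Module A M] [Module K M]
    (ℳ : ι → Submodule K M) (D : ℕ → Set ι) where
  σ : ℕ → Type
  deg : (s : ℕ) → σ s → ι
  deg_mem : ∀ (s : ℕ) (i : σ s), deg s i ∈ D s
  aug : (σ 0 →₀ A) →ₗ[A] M
  d : (s : ℕ) → ((σ (s+1) →₀ A) →ₗ[A] (σ s →₀ A))
  aug_graded : IsGradedMap (K := K) (freeGrading 𝒜 (deg 0)) ℳ aug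
  d_graded : ∀ s : ℕ,
    IsGradedMap (K := K) (freeGrading 𝒜 (deg (s+1))) (freeGrading 𝒜 (deg s)) (d s)
  aug_surj : ∀ j, ∀ m ∈ ℳ j, ∃ f ∈ freeGrading 𝒜 (deg 0) j, aug f = m
  aug_d : aug ∘ₗ d 0 = 0
  d_d : ∀ s, d s ∘ₗ d (s + 1) = 0
  exact_zero : ∀ j, ∀ f ∈ freeGrading 𝒜 (deg 0) j, aug f = 0 →
    ∃ w ∈ freeGrading 𝒜 (deg 1) j, d 0 w = f
  exact_succ : ∀ s j, ∀ f ∈ freeGrading 𝒜 (deg (s+1)) j, d s f = 0 →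
    ∃ w ∈ freeGrading 𝒜 (deg (s+2)) j, d (s+1) w = f

end GradedModules

section Projection

variable {K A ι : Type} [Field K] [CommRing A] [Algebra K A] [AddCommGroup ι] [DecidableEq ι]
  (𝒜 : ι → Submodule K A) [GradedAlgebra 𝒜]

/-- The projection of a graded free module onto a graded component. -/
noncomputable def freeProj {σ : Type} (deg : σ → ι) (j : ι) : (σ →₀ A) →ₗ[K] (σ →₀ A) :=
  Finsupp.lsum K (fun s => (Finsupp.lsingle s : A →ₗ[K] (σ →₀ A)) ∘ₗ
    GradedAlgebra.proj 𝒜 (j - deg s))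

theorem freeProj_apply {σ : Type} (deg : σ → ι) (j : ι) (f : σ →₀ A) (s : σ) :
    freeProj 𝒜 deg j f s = GradedAlgebra.proj 𝒜 (j - deg s) (f s) := by
  classical
  induction f using Finsupp.induction_linear with
  | zero => simp
  | add f g hf hg => simp only [map_add, Finsupp.add_apply, hf, hg]
  | single t a =>
    by_cases h : t = s
    · subst h; simp [freeProj]
    · simp [freeProj, Finsupp.single_eq_of_ne' h]

theorem freeProj_mem {σ : Type} (deg : σ → ι) (j : ι) (f : σ →₀ A) :
    freeProj 𝒜 deg j f ∈ freeGrading 𝒜 deg j := by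
  intro s
  rw [freeProj_apply, GradedAlgebra.proj_apply]
  exact SetLike.coe_mem _

theorem freeProj_of_mem {σ : Type} {deg : σ → ι} {j : ι} {f : σ →₀ A}
    (hf : f ∈ freeGrading 𝒜 deg j) : freeProj 𝒜 deg j f = f := by
  ext s
  rw [freeProj_apply, GradedAlgebra.proj_apply, DirectSum.decompose_of_mem_same _ (hf s)]

theorem freeProj_of_mem_ne {σ : Type} {deg : σ → ι} {i j : ι} (hij : i ≠ j) {f : σ →₀ A}
    (hf : f ∈ freeGrading 𝒜 deg i) : freeProj 𝒜 deg j f = 0 := by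
  ext s
  rw [freeProj_apply, GradedAlgebra.proj_apply, DirectSum.decompose_of_mem_ne _ (hf s)]
  · rfl
  · simpa using hij

theorem free_homogeneous_induction {σ : Type} (deg : σ → ι) {p : (σ →₀ A) → Prop}
    (h0 : p 0) (hadd : ∀ f g, p f → p g → p (f + g))
    (hom : ∀ j, ∀ f ∈ freeGrading 𝒜 deg j, p f) (f : σ →₀ A) : p f := by
  classical
  induction f using Finsupp.induction_linear with
  | zero => exact h0
  | add f g hf hg => exact hadd f g hf hg
  | single s a =>
    induction a using DirectSum.Decomposition.inductionOn 𝒜 with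
    | zero => simpa using h0
    | @homogeneous i m =>
      refine hom (i + deg s) _ fun t => ?_
      by_cases h : s = t
      · subst h; simp
      · simp [Finsupp.single_eq_of_ne' h]
    | add m m' hm hm' => rw [Finsupp.single_add]; exact hadd _ _ hm hm'

theorem freeProj_comm {σ τ : Type} {deg : σ → ι} {deg' : τ → ι} {d : (τ →₀ A) →ₗ[A] (σ →₀ A)}
    (hd : IsGradedMap (K := K) (freeGrading 𝒜 deg') (freeGrading 𝒜 deg) d) (j : ι)
    (f : τ →₀ A) : freeProj 𝒜 deg j (d f) = d (freeProj 𝒜 deg' j f) := by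
  induction f using free_homogeneous_induction 𝒜 deg' with
  | h0 => simp
  | hadd f g hf hg => simp only [map_add, hf, hg]
  | hom i f hf =>
    by_cases h : i = j
    · subst h
      rw [freeProj_of_mem 𝒜 hf, freeProj_of_mem 𝒜 (hd _ _ hf)]
    · rw [freeProj_of_mem_ne 𝒜 h hf, freeProj_of_mem_ne 𝒜 h (hd _ _ hf), map_zero]

theorem exists_sum_freeProj {σ : Type} (deg : σ → ι) (f : σ →₀ A) :
    ∃ J : Finset ι, ∀ J', J ⊆ J' → ∑ j ∈ J', freeProj 𝒜 deg j f = f := by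
  induction f using free_homogeneous_induction 𝒜 deg with
  | h0 => exact ⟨∅, fun J' _ => by simp⟩
  | hadd f g hf hg =>
    obtain ⟨J₁, h₁⟩ := hf
    obtain ⟨J₂, h₂⟩ := hg
    refine ⟨J₁ ∪ J₂, fun J' h => ?_⟩
    simp only [map_add, Finset.sum_add_distrib]
    rw [h₁ J' (Finset.union_subset_left h), h₂ J' (Finset.union_subset_right h)]
  | hom i f hf =>
    refine ⟨{i}, fun J' h => ?_⟩
    rw [Finset.sum_eq_single i]
    · exact freeProj_of_mem 𝒜 hf
    · exact fun j _ hj => freeProj_of_mem_ne 𝒜 hj.symm hf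
    · exact fun hi => absurd (h (Finset.mem_singleton_self i)) hi

theorem aug_freeProj {σ : Type} {deg : σ → ι} {aug : (σ →₀ A) →ₗ[A] (A ⧸ irrelevant 𝒜)}
    (h : IsGradedMap (K := K) (freeGrading 𝒜 deg) (residueGrading K A 𝒜) aug) (f : σ →₀ A) :
    aug (freeProj 𝒜 deg 0 f) = aug f := by
  induction f using free_homogeneous_induction 𝒜 deg with
  | h0 => simp
  | hadd f g hf hg => simp only [map_add, hf, hg]
  | hom i f hf =>
    by_cases hi : i = 0
    · subst hi; rw [freeProj_of_mem 𝒜 hf]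
    · have := h _ _ hf
      rw [residueGrading, if_neg hi, Submodule.mem_bot] at this
      rw [freeProj_of_mem_ne 𝒜 hi hf, this, map_zero]

/-- A graded free resolution of the residue field is exact in each degree. -/
noncomputable def GradedFreeResolution.toHomogeneous {D : ℕ → Set ι}
    (F : GradedFreeResolution K A 𝒜 (A ⧸ irrelevant 𝒜) (residueGrading K A 𝒜) D) :
    HomogeneousResolution 𝒜 (A ⧸ irrelevant 𝒜) (residueGrading K A 𝒜) D where
  σ := F.σ
  deg := F.deg
  deg_mem := F.deg_mem
  aug := F.aug
  d := F.d
  aug_graded := F.aug_graded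
  d_graded := F.d_graded
  aug_surj := by
    intro j m hm
    by_cases hj : j = 0
    · subst hj
      obtain ⟨f, rfl⟩ := F.aug_surjective m
      exact ⟨_, freeProj_mem 𝒜 _ 0 f, aug_freeProj 𝒜 F.aug_graded f⟩
    · rw [residueGrading, if_neg hj, Submodule.mem_bot] at hm
      exact ⟨0, zero_mem _, by rw [hm, map_zero]⟩
  aug_d := by
    ext1 x
    exact LinearMap.ext fun y => (F.exact_zero.le ⟨_, rfl⟩ : F.d 0 (Finsupp.lsingle x y) ∈ _)
  d_d := fun s => by
    ext1 x
    exact LinearMap.ext fun y =>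
      ((F.exact_succ s).le ⟨_, rfl⟩ : F.d (s+1) (Finsupp.lsingle x y) ∈ _)
  exact_zero := by
    intro j f hf h0
    obtain ⟨w, rfl⟩ := F.exact_zero.ge h0
    exact ⟨_, freeProj_mem 𝒜 _ j w, by
      rw [← freeProj_comm 𝒜 (F.d_graded 0), freeProj_of_mem 𝒜 hf]⟩
  exact_succ := by
    intro s j f hf h0
    obtain ⟨w, rfl⟩ := (F.exact_succ s).ge h0
    exact ⟨_, freeProj_mem 𝒜 _ j w, by
      rw [← freeProj_comm 𝒜 (F.d_graded (s+1)), freeProj_of_mem 𝒜 hf]⟩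

theorem mem_range_of_homogeneous {σ τ : Type} {deg : σ → ι} {deg' : τ → ι}
    {d : (τ →₀ A) →ₗ[A] (σ →₀ A)} {f : σ →₀ A}
    (h : ∀ j, ∃ w ∈ freeGrading 𝒜 deg' j, d w = freeProj 𝒜 deg j f) :
    f ∈ LinearMap.range d := by
  obtain ⟨J, hJ⟩ := exists_sum_freeProj 𝒜 deg f
  rw [← hJ J subset_rfl]
  refine sum_mem fun j _ => ?_
  obtain ⟨w, -, hw⟩ := h j
  exact ⟨w, hw⟩

/-- A resolution of the residue field which is exact in each degree is a graded free
resolution. -/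
noncomputable def HomogeneousResolution.toGradedFree {D : ℕ → Set ι}
    (F : HomogeneousResolution 𝒜 (A ⧸ irrelevant 𝒜) (residueGrading K A 𝒜) D) :
    GradedFreeResolution K A 𝒜 (A ⧸ irrelevant 𝒜) (residueGrading K A 𝒜) D where
  σ := F.σ
  deg := F.deg
  deg_mem := F.deg_mem
  aug := F.aug
  d := F.d
  aug_graded := F.aug_graded
  d_graded := F.d_graded
  aug_surjective := fun m => by
    obtain ⟨f, -, hf⟩ := F.aug_surj 0 m (by simp [residueGrading])
    exact ⟨f, hf⟩
  exact_zero := by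
    refine le_antisymm ?_ ?_
    · rintro _ ⟨w, rfl⟩
      exact LinearMap.congr_fun F.aug_d w
    · intro f hf
      refine mem_range_of_homogeneous 𝒜 (deg := F.deg 0) (deg' := F.deg 1) fun j =>
        F.exact_zero j _ (freeProj_mem 𝒜 _ j f) ?_
      by_cases hj : j = 0
      · subst hj; rw [aug_freeProj 𝒜 F.aug_graded]; exact hf
      · have := F.aug_graded _ _ (freeProj_mem 𝒜 (F.deg 0) j f)
        rwa [residueGrading, if_neg hj, Submodule.mem_bot] at this
  exact_succ := by
    intro s
    refine le_antisymm ?_ ?_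
    · rintro _ ⟨w, rfl⟩
      exact LinearMap.congr_fun (F.d_d s) w
    · intro f hf
      refine mem_range_of_homogeneous 𝒜 (deg := F.deg (s+1)) (deg' := F.deg (s+2)) fun j =>
        F.exact_succ s j _ (freeProj_mem 𝒜 _ j f) ?_
      rw [← freeProj_comm 𝒜 (F.d_graded s), LinearMap.mem_ker.mp hf, map_zero]

end Projection

section TorVanishing

variable {K A ι : Type} [Field K] [CommRing A] [Algebra K A] [AddCommGroup ι]
  {𝒜 : ι → Submodule K A} {P : Type} [AddCommGroup P] [Module A P] [Module K P]
  {ℋ : ι → Submodule K P} {D : ℕ → Set ι}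

theorem exists_lift_shiftGrading {M N : Type} [AddCommGroup M] [Module A M] [Module K M]
    [AddCommGroup N] [Module A N] [Module K N] {ℳ : ι → Submodule K M} {𝒩 : ι → Submodule K N}
    {g : M →ₗ[A] N} (hg : ∀ j, ∀ n ∈ 𝒩 j, ∃ m ∈ ℳ j, g m = n) {σ : Type} {deg : σ → ι} {j : ι}
    {z : σ →₀ N} (hz : z ∈ shiftGrading 𝒩 deg j) :
    ∃ w ∈ shiftGrading ℳ deg j, Finsupp.mapRange.linearMap g w = z := by
  classical
  choose f hf hgf using fun s => hg _ _ (hz s)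
  refine ⟨Finsupp.onFinset z.support (fun s => if z s = 0 then 0 else f s) ?_, ?_, ?_⟩
  · intro s hs
    by_contra h
    rw [Finsupp.notMem_support_iff] at h
    simp [h] at hs
  · intro s
    rw [Finsupp.onFinset_apply]
    split_ifs
    · exact zero_mem _
    · exact hf s
  · ext s
    rw [Finsupp.mapRange.linearMap_apply, Finsupp.mapRange_apply, Finsupp.onFinset_apply]
    split_ifs with h
    · rw [map_zero, h]
    · exact hgf s

theorem mapRange_mem_shiftGrading {M N : Type} [AddCommGroup M] [Module A M] [Module K M]
    [AddCommGroup N] [Module A N] [Module K N] {ℳ : ι → Submodule K M} {𝒩 : ι → Submodule K N}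
    {g : M →ₗ[A] N} (hg : ∀ j, ∀ m ∈ ℳ j, g m ∈ 𝒩 j) {σ : Type} {deg : σ → ι} {j : ι}
    {z : σ →₀ M} (hz : z ∈ shiftGrading ℳ deg j) :
    Finsupp.mapRange.linearMap g z ∈ shiftGrading 𝒩 deg j :=
  fun s => by simpa using hg _ _ (hz s)

theorem mem_shiftGrading_ker {M N : Type} [AddCommGroup M] [Module A M] [Module K M]
    [IsScalarTower K A M] [AddCommGroup N] [Module A N] {ℳ : ι → Submodule K M}
    {g : M →ₗ[A] N} {σ : Type} {deg : σ → ι} {j : ι} {z : σ →₀ M} :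
    z ∈ shiftGrading (kerGrading ℳ g) deg j ↔
      z ∈ shiftGrading ℳ deg j ∧ Finsupp.mapRange.linearMap g z = 0 := by
  constructor
  · intro h
    refine ⟨fun s => (mem_kerGrading.mp (h s)).1, ?_⟩
    ext s
    simpa using (mem_kerGrading.mp (h s)).2
  · rintro ⟨h, h0⟩ s
    refine mem_kerGrading.mpr ⟨h s, ?_⟩
    simpa using DFunLike.congr_fun h0 s

namespace HomogeneousResolution

variable (Q : HomogeneousResolution 𝒜 P ℋ D)

/-- Cycles of the complex `M ⊗ Q`. -/
def IsCycle (M : Type) [AddCommGroup M] [Module A M] : (i : ℕ) → (Q.σ i →₀ M) → Prop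
  | 0, _ => True
  | i + 1, z => tens M (Q.d i) z = 0

/-- Vanishing of `Tor_i(M, P)` in degree `j`, computed from the resolution `Q` of `P`. -/
def TorVan {M : Type} [AddCommGroup M] [Module A M] [Module K M]
    (ℳ : ι → Submodule K M) (i : ℕ) (j : ι) : Prop :=
  ∀ z ∈ shiftGrading ℳ (Q.deg i) j, Q.IsCycle M i z →
    ∃ w ∈ shiftGrading ℳ (Q.deg (i + 1)) j, tens M (Q.d i) w = z

theorem d_single_mem [SetLike.GradedMonoid 𝒜] (s : ℕ) (t : Q.σ (s + 1)) :
    Q.d s (Finsupp.single t 1) ∈ freeGrading 𝒜 (Q.deg s) (Q.deg (s + 1) t) :=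
  Q.d_graded s _ _ (single_mem_freeGrading _ t)

variable {M N : Type} [AddCommGroup M] [Module A M] [Module K M]
    [AddCommGroup N] [Module A N] [Module K N] {ℳ : ι → Submodule K M} {𝒩 : ι → Submodule K N}

theorem tens_d_mem [SetLike.GradedMonoid 𝒜] (hM : GradedCompat 𝒜 ℳ) {s : ℕ} {j : ι}
    {x : Q.σ (s + 1) →₀ M} (hx : x ∈ shiftGrading ℳ (Q.deg (s + 1)) j) :
    tens M (Q.d s) x ∈ shiftGrading ℳ (Q.deg s) j :=
  tens_mem_shiftGrading hM (Q.d_single_mem s) hx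

omit [Module K M] in
theorem isCycle_tens (i : ℕ) (x : Q.σ (i + 1) →₀ M) : Q.IsCycle M i (tens M (Q.d i) x) := by
  cases i with
  | zero => trivial
  | succ i => exact (tens_tens _ _ _).trans (by rw [Q.d_d, tens_zero])

omit [Module K M] [Module K N] in
theorem IsCycle.mapRange {i : ℕ} {z : Q.σ i →₀ M} (hz : Q.IsCycle M i z) (g : M →ₗ[A] N) :
    Q.IsCycle N i (Finsupp.mapRange.linearMap g z) := by
  cases i with
  | zero => trivial
  | succ i =>
    change tens _ _ _ = 0
    rw [← mapRange_tens, show tens M (Q.d i) z = 0 from hz, map_zero]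

theorem TorVan.of_surjective [SetLike.GradedMonoid 𝒜] [IsScalarTower K A M]
    (hM : GradedCompat 𝒜 ℳ) {g : M →ₗ[A] N} (hg : ∀ j, ∀ m ∈ ℳ j, g m ∈ 𝒩 j)
    (hs : ∀ j, ∀ n ∈ 𝒩 j, ∃ m ∈ ℳ j, g m = n) {i : ℕ} {j : ι} (h : Q.TorVan ℳ i j)
    (hk : ∀ k, i = k + 1 → Q.TorVan (kerGrading ℳ g) k j) : Q.TorVan 𝒩 i j := by
  intro z hz hc
  obtain ⟨y, hy, rfl⟩ := exists_lift_shiftGrading hs hz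
  cases i with
  | zero =>
    obtain ⟨w, hw, rfl⟩ := h y hy trivial
    exact ⟨_, mapRange_mem_shiftGrading hg hw, (mapRange_tens _ _ _).symm⟩
  | succ k =>
    have hc' : tens N (Q.d k) (Finsupp.mapRange.linearMap g y) = 0 := hc
    rw [← mapRange_tens] at hc'
    obtain ⟨u, hu, hu'⟩ := hk k rfl _ (mem_shiftGrading_ker.mpr ⟨Q.tens_d_mem hM hy, hc'⟩)
      (Q.isCycle_tens k y)
    rw [mem_shiftGrading_ker] at hu
    obtain ⟨w, hw, hw'⟩ := h (y - u) (sub_mem hy hu.1)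
      (show tens _ _ _ = 0 by rw [map_sub, hu', sub_self])
    refine ⟨_, mapRange_mem_shiftGrading hg hw, ?_⟩
    rw [← mapRange_tens, hw', map_sub, hu.2, sub_zero]

theorem TorVan.ker [SetLike.GradedMonoid 𝒜] [IsScalarTower K A M]
    (hM : GradedCompat 𝒜 ℳ) {g : M →ₗ[A] N} (hg : ∀ j, ∀ m ∈ ℳ j, g m ∈ 𝒩 j)
    (hs : ∀ j, ∀ n ∈ 𝒩 j, ∃ m ∈ ℳ j, g m = n) {i : ℕ} {j : ι} (h : Q.TorVan ℳ i j)
    (h' : Q.TorVan 𝒩 (i + 1) j) : Q.TorVan (kerGrading ℳ g) i j := by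
  intro z hz hc
  rw [mem_shiftGrading_ker] at hz
  obtain ⟨w, hw, rfl⟩ := h z hz.1 hc
  obtain ⟨y, hy, hy'⟩ := h' _ (mapRange_mem_shiftGrading hg hw)
    (show tens _ _ _ = 0 by rw [← mapRange_tens, hz.2])
  obtain ⟨v, hv, rfl⟩ := exists_lift_shiftGrading hs hy
  refine ⟨w - tens M (Q.d (i + 1)) v, mem_shiftGrading_ker.mpr
    ⟨sub_mem hw (Q.tens_d_mem hM hv), ?_⟩, ?_⟩
  · rw [map_sub, mapRange_tens, hy', sub_self]
  · rw [map_sub, show tens M (Q.d i) (tens M (Q.d (i + 1)) v) = 0 from Q.isCycle_tens (i + 1) v,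
      sub_zero]

theorem TorVan.of_bijective {g : M →ₗ[A] N} (hg : ∀ j, ∀ m ∈ ℳ j, g m ∈ 𝒩 j)
    (hs : ∀ j, ∀ n ∈ 𝒩 j, ∃ m ∈ ℳ j, g m = n) (hi : ∀ j, ∀ m ∈ ℳ j, g m = 0 → m = 0)
    [SetLike.GradedMonoid 𝒜] (hM : GradedCompat 𝒜 ℳ) {i : ℕ} {j : ι}
    (h : Q.TorVan 𝒩 i j) : Q.TorVan ℳ i j := by
  intro z hz hc
  obtain ⟨y, hy, hy'⟩ := h _ (mapRange_mem_shiftGrading hg hz) (IsCycle.mapRange Q hc g)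
  obtain ⟨v, hv, rfl⟩ := exists_lift_shiftGrading hs hy
  refine ⟨v, hv, ?_⟩
  rw [← mapRange_tens] at hy'
  rw [← sub_eq_zero]
  ext s
  refine hi _ _ (sub_mem (Q.tens_d_mem hM hv s) (hz s)) ?_
  have := DFunLike.congr_fun hy' s
  simp only [Finsupp.mapRange.linearMap_apply, Finsupp.mapRange_apply] at this
  rw [Finsupp.sub_apply, map_sub, this, sub_self]

theorem torVan_of_eq_bot {i : ℕ} {j : ι} (h : ∀ s, ℳ (j - Q.deg i s) = ⊥) :
    Q.TorVan ℳ i j := by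
  intro z hz _
  have : z = 0 := by
    ext s
    have := hz s
    rwa [h, Submodule.mem_bot] at this
  exact ⟨0, zero_mem _, by rw [this, map_zero]⟩

theorem torVan_shift (ℳ : ι → Submodule K M) (c : ι) (i : ℕ) (j : ι) :
    Q.TorVan (fun j => ℳ (j - c)) i j ↔ Q.TorVan ℳ i (j - c) := by
  have : ∀ i, shiftGrading (fun j => ℳ (j - c)) (Q.deg i) j =
      shiftGrading ℳ (Q.deg i) (j - c) := fun i => by
    ext z
    refine forall_congr' fun s => ?_
    rw [sub_right_comm]
  rw [TorVan, TorVan, this, this]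

theorem TorVan.sum {κ : Type} {𝒩 : κ → ι → Submodule K N} {i : ℕ} {j : ι}
    (h : ∀ k, Q.TorVan (𝒩 k) i j) : Q.TorVan (sumGrading 𝒩) i j := by
  classical
  intro z hz hc
  have hz' : ∀ k, Finsupp.mapRange.linearMap (Finsupp.lapply k : (κ →₀ N) →ₗ[A] N) z ∈
      shiftGrading (𝒩 k) (Q.deg i) j := fun k s => by simpa using hz s k
  choose w hw hw' using fun k => h k _ (hz' k) (IsCycle.mapRange Q hc _)
  let T : Finset κ := z.support.biUnion fun s => (z s).support
  have hzT : z = ∑ k ∈ T, Finsupp.mapRange.linearMap (Finsupp.lsingle k : N →ₗ[A] (κ →₀ N))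
      (Finsupp.mapRange.linearMap (Finsupp.lapply k : (κ →₀ N) →ₗ[A] N) z) := by
    ext s k
    rw [Finsupp.finsetSum_apply, Finsupp.finsetSum_apply]
    by_cases hk : k ∈ T
    · rw [Finset.sum_eq_single k]
      · simp
      · intro b _ hb
        simp [Finsupp.single_eq_of_ne' hb]
      · exact fun h => absurd hk h
    · rw [Finset.sum_eq_zero]
      · by_contra h0
        refine hk (Finset.mem_biUnion.mpr ⟨s, ?_, Finsupp.mem_support_iff.mpr h0⟩)
        rw [Finsupp.mem_support_iff]
        intro h1
        rw [h1] at h0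
        exact h0 rfl
      · intro b hb
        have : b ≠ k := fun h => hk (h ▸ hb)
        simp [Finsupp.single_eq_of_ne' this]
  refine ⟨∑ k ∈ T, Finsupp.mapRange.linearMap (Finsupp.lsingle k : N →ₗ[A] (κ →₀ N)) (w k),
    sum_mem fun k _ => ?_, ?_⟩
  · refine mapRange_mem_shiftGrading (ℳ := 𝒩 k) (𝒩 := sumGrading 𝒩)
      (fun j m hm k' => ?_) (hw k)
    by_cases hk : k = k'
    · subst hk; simpa using hm
    · simp [Finsupp.single_eq_of_ne' hk]
  · conv_rhs => rw [hzT]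
    rw [map_sum]
    exact Finset.sum_congr rfl fun k _ => by rw [← mapRange_tens, hw']

theorem torVan_self {i : ℕ} {j : ι} (h : i ≠ 0 ∨ ℋ j = ⊥) : Q.TorVan 𝒜 i j := by
  intro z hz hc
  simp only [tens_self]
  cases i with
  | zero =>
    refine Q.exact_zero j z hz ?_
    have := Q.aug_graded j z hz
    rwa [h.resolve_left (by simp), Submodule.mem_bot] at this
  | succ k =>
    have hc' : tens _ _ _ = 0 := hc
    rw [tens_self] at hc'
    exact Q.exact_succ k j z hz hc'

theorem torVan_free {i : ℕ} {j : ι} {τ : Type} {deg : τ → ι}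
    (h : ∀ t, i ≠ 0 ∨ ℋ (j - deg t) = ⊥) : Q.TorVan (freeGrading 𝒜 deg) i j :=
  TorVan.sum Q (𝒩 := fun t j => 𝒜 (j - deg t)) fun t =>
    (Q.torVan_shift 𝒜 _ _ _).mpr (Q.torVan_self (h t))

theorem TorVan.of_complex [SetLike.GradedMonoid 𝒜] : ∀ {i : ℕ} {N : ℕ → Type}
    [∀ s, AddCommGroup (N s)] [∀ s, Module A (N s)] [∀ s, Module K (N s)]
    [∀ s, IsScalarTower K A (N s)] {M : Type} [AddCommGroup M] [Module A M] [Module K M]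
    {𝒩 : (s : ℕ) → ι → Submodule K (N s)} {ℳ : ι → Submodule K M}
    (ε : N 0 →ₗ[A] M) (d : (s : ℕ) → N (s + 1) →ₗ[A] N s)
    {j : ι} (_ : ∀ s, GradedCompat 𝒜 (𝒩 s))
    (_ : ∀ j, ∀ n ∈ 𝒩 0 j, ε n ∈ ℳ j)
    (_ : ∀ s j, ∀ n ∈ 𝒩 (s + 1) j, d s n ∈ 𝒩 s j)
    (_ : ∀ j, ∀ m ∈ ℳ j, ∃ n ∈ 𝒩 0 j, ε n = m)
    (_ : ∀ j, ∀ n ∈ 𝒩 1 j, ε (d 0 n) = 0)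
    (_ : ∀ s j, ∀ n ∈ 𝒩 (s + 2) j, d s (d (s + 1) n) = 0)
    (_ : ∀ j, ∀ n ∈ 𝒩 0 j, ε n = 0 → ∃ n' ∈ 𝒩 1 j, d 0 n' = n)
    (_ : ∀ s j, ∀ n ∈ 𝒩 (s + 1) j, d s n = 0 → ∃ n' ∈ 𝒩 (s + 2) j, d (s + 1) n' = n)
    (_ : ∀ s, s ≤ i → Q.TorVan (𝒩 s) (i - s) j), Q.TorVan ℳ i j
  | 0, _, _, _, _, _, _, _, _, _, _, _, ε, d, _, hc, hε, _, hs, _, _, _, _, hT =>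
    TorVan.of_surjective Q (hc 0) hε hs (hT 0 le_rfl) (by simp)
  | i + 1, N, _, _, _, _, M, _, _, _, 𝒩, ℳ, ε, d, j, hc, hε, hd, hs, hεd, hdd, he0, hes, hT =>
    TorVan.of_surjective Q (hc 0) hε hs (hT 0 (by lia)) fun k hk => by
      obtain rfl : i = k := by lia
      exact TorVan.of_complex (i := i) (N := fun s => N (s + 1)) (M := N 0)
        (𝒩 := fun s => 𝒩 (s + 1)) (ℳ := kerGrading (𝒩 0) ε) (d 0) (fun s => d (s + 1))
        (fun s => hc _) (fun j n hn => mem_kerGrading.mpr ⟨hd 0 j n hn, hεd j n hn⟩)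
        (fun s => hd _) (fun j m hm => he0 j m (mem_kerGrading.mp hm).1 (mem_kerGrading.mp hm).2)
        (hdd 0) (fun s => hdd _) (hes 0) (fun s => hes _)
        (fun s hs => by
          have := hT (s + 1) (by lia)
          rwa [Nat.add_sub_add_right] at this)

end HomogeneousResolution

end TorVanishing

section Construction

variable {K A ι : Type} [Field K] [CommRing A] [Algebra K A] [AddCommGroup ι]
  (𝒜 : ι → Submodule K A)

/-- A graded free module together with a family of subspaces to be covered by the next
step of a resolution. -/
structure ResolutionStage where
  σ : Type
  deg : σ → ι
  ℒ : ι → Submodule K (σ →₀ A)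
  le_free : ∀ j, ℒ j ≤ freeGrading 𝒜 deg j

variable {𝒜}

/-- The stage given by the kernel of a map out of a graded free module. -/
noncomputable abbrev ResolutionStage.ofMap {σ N : Type} [AddCommGroup N] [Module A N] (deg : σ → ι)
    (g : (σ →₀ A) →ₗ[A] N) : ResolutionStage 𝒜 :=
  ⟨σ, deg, kerGrading (freeGrading 𝒜 deg) g, fun _ => inf_le_left⟩

theorem exists_homogeneousResolution [SetLike.GradedMonoid 𝒜] {M : Type} [AddCommGroup M]
    [Module A M] [Module K M] {ℳ : ι → Submodule K M} {D : ℕ → Set ι}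
    (Pr : ℕ → ResolutionStage 𝒜 → Prop)
    (h0 : ∃ (σ : Type) (deg : σ → ι) (aug : (σ →₀ A) →ₗ[A] M), (∀ t, deg t ∈ D 0) ∧
      (∀ j, ∀ f ∈ freeGrading 𝒜 deg j, aug f ∈ ℳ j) ∧
      (∀ j, ∀ m ∈ ℳ j, ∃ f ∈ freeGrading 𝒜 deg j, aug f = m) ∧
      Pr 0 (ResolutionStage.ofMap deg aug))
    (hs : ∀ s (X : ResolutionStage 𝒜), Pr s X → ∃ (τ : Type) (deg : τ → ι)
      (g : (τ →₀ A) →ₗ[A] (X.σ →₀ A)), (∀ t, deg t ∈ D (s + 1)) ∧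
      (∀ j, ∀ f ∈ freeGrading 𝒜 deg j, g f ∈ X.ℒ j) ∧
      (∀ j, ∀ m ∈ X.ℒ j, ∃ f ∈ freeGrading 𝒜 deg j, g f = m) ∧
      Pr (s + 1) (ResolutionStage.ofMap deg g)) :
    Nonempty (HomogeneousResolution 𝒜 M ℳ D) := by
  obtain ⟨σ₀, deg₀, aug, hD₀, hg₀, hs₀, hP₀⟩ := h0
  choose τ deg g hD hg hsurj hP using hs
  let seq : (s : ℕ) → {X : ResolutionStage 𝒜 // Pr s X} := fun s =>
    Nat.rec ⟨ResolutionStage.ofMap deg₀ aug, hP₀⟩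
      (fun s X => ⟨ResolutionStage.ofMap (deg s X.1 X.2) (g s X.1 X.2), hP s X.1 X.2⟩) s
  have key : ∀ {N : Type} [AddCommGroup N] [Module A N] {τ σ : Type} {deg' : τ → ι}
      {deg : σ → ι} (f : (σ →₀ A) →ₗ[A] N) (g : (τ →₀ A) →ₗ[A] (σ →₀ A)),
      (∀ j, ∀ x ∈ freeGrading 𝒜 deg' j, g x ∈ kerGrading (freeGrading 𝒜 deg) f j) →
      f ∘ₗ g = 0 := by
    intro N _ _ τ σ deg' deg f g h
    ext t
    exact (mem_kerGrading.mp (h _ _ (single_mem_freeGrading deg' t))).2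
  exact ⟨{
    σ := fun s => (seq s).1.σ
    deg := fun s => (seq s).1.deg
    deg_mem := fun s => by
      cases s with
      | zero => exact hD₀
      | succ s => exact hD s _ _
    aug := aug
    d := fun s => g s (seq s).1 (seq s).2
    aug_graded := hg₀
    d_graded := fun s j x hx => (seq s).1.le_free j (hg s _ (seq s).2 j x hx)
    aug_surj := hs₀
    aug_d := key (deg := deg₀) aug _ (hg 0 _ (seq 0).2)
    d_d := fun s => key (deg := (seq (s + 1)).1.deg) (g s _ (seq s).2) _
      (hg (s + 1) _ (seq (s + 1)).2)
    exact_zero := fun j f hf h0 => hsurj 0 _ (seq 0).2 j f ⟨hf, h0⟩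
    exact_succ := fun s j f hf h0 =>
      hsurj (s + 1) _ (seq (s + 1)).2 j f ⟨hf, h0⟩ }⟩

/-- The algebra is positively graded with respect to the weight `ω`, and `𝒜 0` consists of
scalars. -/
structure ConnectedBy (𝒜 : ι → Submodule K A) (ω : ι →+ ℤ) : Prop where
  eq_bot_of_neg : ∀ p, ω p < 0 → 𝒜 p = ⊥
  eq_bot_of_zero : ∀ p, ω p = 0 → p ≠ 0 → 𝒜 p = ⊥
  scalar : ∀ x ∈ 𝒜 0, ∃ c : K, x = algebraMap K A c

variable {P : Type} [AddCommGroup P] [Module A P] [Module K P]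
  {ℋ : ι → Submodule K P} {D : ℕ → Set ι} (Q : HomogeneousResolution 𝒜 P ℋ D)

/-- A module with `r`-linear Tor, concentrated in degrees from `S`. -/
structure LinearTor {M : Type} [AddCommGroup M] [Module A M] [Module K M]
    (ω : ι →+ ℤ) (S : Set ι) (r : ℤ) (ℳ : ι → Submodule K M) : Prop where
  compat : GradedCompat 𝒜 ℳ
  low : ∀ j, ω j < r → ℳ j = ⊥
  supp : ∀ j, j ∉ S → ℳ j = ⊥
  tor : ∀ (i : ℕ) (j : ι), i + r < ω j → Q.TorVan ℳ i j

variable {Q}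

/-- The graded pieces of the submodule generated by homogeneous elements. -/
noncomputable def spanGrading {M τ : Type} [AddCommGroup M] [Module A M] [Module K M]
    [IsScalarTower K A M]
    (𝒜 : ι → Submodule K A) (deg : τ → ι) (g : τ → M) (j : ι) : Submodule K M :=
  (freeGrading 𝒜 deg j).map ((Finsupp.linearCombination A g).restrictScalars K)

theorem mem_spanGrading {M τ : Type} [AddCommGroup M] [Module A M] [Module K M]
    [IsScalarTower K A M] {deg : τ → ι} {g : τ → M} {j : ι} {m : M} :
    m ∈ spanGrading 𝒜 deg g j ↔
      ∃ f ∈ freeGrading 𝒜 deg j, Finsupp.linearCombination A g f = m := by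
  simp [spanGrading]

theorem gradedCompat_spanGrading [SetLike.GradedMonoid 𝒜] {M τ : Type} [AddCommGroup M]
    [Module A M] [Module K M] [IsScalarTower K A M] (deg : τ → ι) (g : τ → M) :
    GradedCompat 𝒜 (spanGrading 𝒜 deg g) := by
  intro p q a m ha hm
  obtain ⟨f, hf, rfl⟩ := mem_spanGrading.mp hm
  exact mem_spanGrading.mpr ⟨a • f, gradedCompat_free 𝒜 deg p q a f ha hf, map_smul _ _ _⟩

theorem LinearTor.le_spanGrading [SetLike.GradedMonoid 𝒜] {M τ : Type} [AddCommGroup M]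
    [Module A M] [Module K M] [IsScalarTower K A M] {ω : ι →+ ℤ} {S : Set ι} {r : ℤ}
    {ℳ : ι → Submodule K M} (h : LinearTor Q ω S r ℳ)
    (hD0 : ∀ v ∈ D 0, ω v = 0) (hD1 : ∀ v ∈ D 1, 0 < ω v) (s₀ : Q.σ 0) {deg : τ → ι} {g : τ → M}
    (hg : ∀ v, ω v = r → v ∈ S → ℳ v ≤ spanGrading 𝒜 deg g v) (j : ι) :
    ℳ j ≤ spanGrading 𝒜 deg g j := by
  classical
  obtain ⟨n, hn⟩ : ∃ n : ℕ, (ω j - r).toNat = n := ⟨_, rfl⟩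
  induction n using Nat.strong_induction_on generalizing j with
  | _ n ih =>
  rcases lt_trichotomy (ω j) r with hj | hj | hj
  · rw [h.low j hj]; exact bot_le
  · by_cases hS : j ∈ S
    · exact hg j hj hS
    · rw [h.supp j hS]; exact bot_le
  · intro m hm
    have h₀ : ω (Q.deg 0 s₀) = 0 := hD0 _ (Q.deg_mem 0 s₀)
    obtain ⟨w, hw, hwz⟩ := h.tor 0 (j + Q.deg 0 s₀) (by simpa [h₀] using hj)
      (Finsupp.single s₀ m) (fun t => by
        by_cases ht : s₀ = t
        · subst ht; simpa using hm
        · simp [Finsupp.single_eq_of_ne' ht]) trivial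
    have hm' : m = ∑ t ∈ w.support, Q.d 0 (Finsupp.single t 1) s₀ • w t := by
      have := DFunLike.congr_fun hwz s₀
      rw [Finsupp.single_eq_same, tens, Finsupp.lsum_apply, Finsupp.sum,
        Finsupp.finsetSum_apply] at this
      rw [← this]
      exact Finset.sum_congr rfl fun t _ => outer_apply _ _ _
    rw [hm']
    refine sum_mem fun t _ => ?_
    have ht : 0 < ω (Q.deg 1 t) := hD1 _ (Q.deg_mem 1 t)
    have h1 : ω (j + Q.deg 0 s₀ - Q.deg 1 t) = ω j - ω (Q.deg 1 t) := by
      rw [map_sub, map_add, h₀, add_zero]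
    have := gradedCompat_spanGrading deg g _ _ _ _ (Q.d_single_mem 0 t s₀)
      (ih _ (by lia) (j + Q.deg 0 s₀ - Q.deg 1 t) rfl (hw t))
    rwa [show Q.deg (0 + 1) t - Q.deg 0 s₀ + (j + Q.deg 0 s₀ - Q.deg 1 t) = j by
      abel] at this

theorem LinearTor.exists_cover [SetLike.GradedMonoid 𝒜] {M : Type} [AddCommGroup M]
    [Module A M] [Module K M] [IsScalarTower K A M] {ω : ι →+ ℤ} {S : Set ι} {r : ℤ}
    {ℳ : ι → Submodule K M} (h : LinearTor Q ω S r ℳ) (hA : ConnectedBy 𝒜 ω)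
    (hS : ∀ v ∈ S, ∀ p, p + v ∉ S → 𝒜 p = ⊥) (hℋ : ∀ v, ω v ≠ 0 → ℋ v = ⊥)
    (hD0 : ∀ v ∈ D 0, ω v = 0) (hD1 : ∀ v ∈ D 1, 0 < ω v) (s₀ : Q.σ 0) :
    ∃ (τ : Type) (deg : τ → ι) (g : (τ →₀ A) →ₗ[A] M), (∀ t, ω (deg t) = r ∧ deg t ∈ S) ∧
      (∀ j, ∀ f ∈ freeGrading 𝒜 deg j, g f ∈ ℳ j) ∧
      (∀ j, ∀ m ∈ ℳ j, ∃ f ∈ freeGrading 𝒜 deg j, g f = m) ∧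
      LinearTor Q ω S (r + 1) (kerGrading (freeGrading 𝒜 deg) g) := by
  classical
  let I : Set ι := {v | ω v = r ∧ v ∈ S}
  let β : (v : I) → Module.Basis (Module.Basis.ofVectorSpaceIndex K (ℳ v)) K (ℳ v) :=
    fun v => Module.Basis.ofVectorSpace K (ℳ v)
  let τ := Σ v : I, Module.Basis.ofVectorSpaceIndex K (ℳ v)
  let deg : τ → ι := fun t => t.1
  let g : τ → M := fun t => (β t.1 t.2 : M)
  have hg : ∀ t, g t ∈ ℳ (deg t) := fun t => (β t.1 t.2).2
  have hdeg : ∀ t, ω (deg t) = r ∧ deg t ∈ S := fun t => t.1.2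
  have hgr : ∀ j, ∀ f ∈ freeGrading 𝒜 deg j, Finsupp.linearCombination A g f ∈ ℳ j :=
    fun j f hf => linearCombination_mem h.compat hg hf
  have hsurj : ∀ j, ∀ m ∈ ℳ j, ∃ f ∈ freeGrading 𝒜 deg j,
      Finsupp.linearCombination A g f = m := by
    refine fun j m hm => mem_spanGrading.mp (h.le_spanGrading hD0 hD1 s₀ (fun v hv hvS => ?_) j hm)
    have hsp := (β ⟨v, hv, hvS⟩).span_eq
    intro m hm
    have : (⟨m, hm⟩ : ℳ v) ∈ Submodule.span K (Set.range (β ⟨v, hv, hvS⟩)) := hsp ▸ trivial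
    have := Submodule.mem_map_of_mem (f := (ℳ v).subtype) this
    rw [Submodule.map_span] at this
    refine Submodule.span_le.mpr ?_ this
    rintro _ ⟨_, ⟨b, rfl⟩, rfl⟩
    exact mem_spanGrading.mpr ⟨Finsupp.single ⟨⟨v, hv, hvS⟩, b⟩ 1,
      single_mem_freeGrading deg ⟨⟨v, hv, hvS⟩, b⟩, by simp [g]⟩
  refine ⟨τ, deg, Finsupp.linearCombination A g, hdeg, hgr, hsurj, ⟨?_, ?_, ?_, ?_⟩⟩
  · exact (gradedCompat_free 𝒜 deg).ker _
  · intro j hj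
    rw [eq_bot_iff]
    intro f hf
    rw [mem_kerGrading] at hf
    obtain ⟨hf, hf0⟩ := hf
    rw [Submodule.mem_bot]
    have hne : ∀ t, j ≠ deg t → f t = 0 := by
      intro t ht
      have h1 := hf t
      have h2 : ω (j - deg t) = ω j - r := by rw [map_sub, (hdeg t).1]
      rcases (show ω j ≤ r by lia).lt_or_eq with h3 | h3
      · rwa [hA.eq_bot_of_neg _ (by lia), Submodule.mem_bot] at h1
      · rwa [hA.eq_bot_of_zero _ (by lia) (sub_ne_zero.mpr ht), Submodule.mem_bot] at h1
    have hc : ∀ t, ∃ c : K, f t = algebraMap K A c := by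
      intro t
      by_cases ht : j = deg t
      · have h1 := hf t
        rw [ht, sub_self] at h1
        exact hA.scalar _ h1
      · exact ⟨0, by rw [hne t ht, map_zero]⟩
    choose c hc using hc
    ext ⟨v, i⟩
    by_cases hv : j = v
    swap
    · exact hne ⟨v, i⟩ hv
    have hli : LinearIndependent K (fun i => ((β v i : ℳ v) : M)) :=
      (β v).linearIndependent.map' (ℳ v).subtype (Submodule.ker_subtype _)
    have hinj : Function.Injective (fun i => (⟨v, i⟩ : τ)) :=
    fun i i' hii => eq_of_heq (Sigma.mk.inj hii).2
    rw [linearIndependent_iff'] at hli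
    by_cases hi : (⟨v, i⟩ : τ) ∈ f.support
    · have := hli (f.support.preimage (fun i => ⟨v, i⟩) hinj.injOn) (fun i => c ⟨v, i⟩) (by
        rw [Finsupp.linearCombination_apply, Finsupp.sum] at hf0
        rw [← hf0, ← Finset.sum_preimage (fun i => ⟨v, i⟩) f.support hinj.injOn
          (fun t => f t • g t)]
        · refine Finset.sum_congr rfl fun i _ => ?_
          rw [hc, algebraMap_smul]
        · rintro ⟨v', i'⟩ ht hn
          rw [hne _ (fun h => hn ?_), zero_smul]
          obtain rfl : v = v' := Subtype.ext (hv.symm.trans h)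
          exact ⟨i', rfl⟩) i (Finset.mem_preimage.mpr hi)
      rw [hc, this, map_zero]; rfl
    · simpa using hi
  · intro j hj
    rw [eq_bot_iff]
    intro f hf
    rw [mem_kerGrading] at hf
    rw [Submodule.mem_bot]
    ext t
    have h1 := hf.1 t
    rwa [hS _ (hdeg t).2 _ (by rwa [sub_add_cancel]), Submodule.mem_bot] at h1
  · intro i j hij
    refine HomogeneousResolution.TorVan.ker Q (gradedCompat_free 𝒜 deg) hgr hsurj ?_ ?_
    · refine Q.torVan_free fun t => ?_
      rcases Nat.eq_zero_or_pos i with rfl | hi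
      · right
        refine hℋ _ ?_
        rw [map_sub, (hdeg t).1]
        push_cast at hij
        lia
      · left; lia
    · exact h.tor _ _ (by push_cast; lia)

theorem LinearTor.exists_resolution [SetLike.GradedMonoid 𝒜] {M : Type} [AddCommGroup M]
    [Module A M] [Module K M] [IsScalarTower K A M] {ω : ι →+ ℤ} {S : Set ι} {r : ℤ}
    {ℳ : ι → Submodule K M} (h : LinearTor Q ω S r ℳ) (hA : ConnectedBy 𝒜 ω)
    (hS : ∀ v ∈ S, ∀ p, p + v ∉ S → 𝒜 p = ⊥) (hℋ : ∀ v, ω v ≠ 0 → ℋ v = ⊥)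
    (hD0 : ∀ v ∈ D 0, ω v = 0) (hD1 : ∀ v ∈ D 1, 0 < ω v) (s₀ : Q.σ 0) :
    Nonempty (HomogeneousResolution 𝒜 M ℳ fun s => {v | ω v = r + s ∧ v ∈ S}) := by
  refine exists_homogeneousResolution
    (fun s X => LinearTor Q ω S (r + s + 1) X.ℒ) ?_ ?_
  · obtain ⟨τ, deg, g, h1, h2, h3, h4⟩ := h.exists_cover hA hS hℋ hD0 hD1 s₀
    exact ⟨τ, deg, g, by simpa using h1, h2, h3,
      by rw [Nat.cast_zero, add_zero]; exact h4⟩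
  · intro s X hX
    obtain ⟨τ, deg, g, h1, h2, h3, h4⟩ := hX.exists_cover hA hS hℋ hD0 hD1 s₀
    refine ⟨τ, deg, g, fun t => ?_, h2, h3, ?_⟩
    · obtain ⟨h5, h6⟩ := h1 t
      exact ⟨by push_cast; lia, h6⟩
    · push_cast
      rwa [← add_assoc]

end Construction

section ResidueField

variable {K A ι : Type} [Field K] [CommRing A] [Algebra K A] [AddCommGroup ι] [DecidableEq ι]
  (𝒜 : ι → Submodule K A) [GradedAlgebra 𝒜]

open scoped Classical in
/-- The projection of a graded algebra onto the components with degrees in a face `T` of the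
set of degrees, which is a ring homomorphism. -/
noncomputable def faceProj (T : ι → Prop) (h0 : T 0)
    (hT : ∀ p q, 𝒜 p = ⊥ ∨ 𝒜 q = ⊥ ∨ (T (p + q) ↔ T p ∧ T q)) : A →ₐ[K] A :=
  (DirectSum.toAlgebra K (fun i => 𝒜 i) (fun i => if T i then (𝒜 i).subtype else 0)
    (by rw [if_pos h0]; rfl)
    (by
      intro p q x y
      rcases hT p q with h | h | h
      · have : x = 0 := Subtype.ext (by simpa [h] using x.2)
        have h' : (x : A) * y = 0 := by rw [this, ZeroMemClass.coe_zero, zero_mul]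
        rw [this, map_zero, zero_mul, ← this]
        split_ifs
        · exact h'
        · rfl
      · have : y = 0 := Subtype.ext (by simpa [h] using y.2)
        have h' : (x : A) * y = 0 := by rw [this, ZeroMemClass.coe_zero, mul_zero]
        rw [this, map_zero, mul_zero, ← this]
        split_ifs
        · exact h'
        · rfl
      · by_cases h1 : T p <;> by_cases h2 : T q <;> simp [h, h1, h2])).comp
  (DirectSum.decomposeAlgEquiv 𝒜).toAlgHom

variable {T : ι → Prop} (h0 : T 0)
    (hT : ∀ p q, 𝒜 p = ⊥ ∨ 𝒜 q = ⊥ ∨ (T (p + q) ↔ T p ∧ T q))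

open scoped Classical in
theorem faceProj_of_mem {p : ι} (hp : T p) {x : A} (hx : x ∈ 𝒜 p) :
    faceProj 𝒜 T h0 hT x = x := by
  simp only [faceProj, AlgHom.comp_apply]
  refine (congrArg _ (DirectSum.decompose_of_mem 𝒜 hx)).trans ?_
  refine (DirectSum.toAddMonoid_of (fun i => LinearMap.toAddMonoidHom
    (if T i then (𝒜 i).subtype else 0 : 𝒜 i →ₗ[K] A)) p ⟨x, hx⟩).trans ?_
  simp [hp]

open scoped Classical in
theorem faceProj_of_mem_not {p : ι} (hp : ¬ T p) {x : A} (hx : x ∈ 𝒜 p) :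
    faceProj 𝒜 T h0 hT x = 0 := by
  simp only [faceProj, AlgHom.comp_apply]
  refine (congrArg _ (DirectSum.decompose_of_mem 𝒜 hx)).trans ?_
  refine (DirectSum.toAddMonoid_of (fun i => LinearMap.toAddMonoidHom
    (if T i then (𝒜 i).subtype else 0 : 𝒜 i →ₗ[K] A)) p ⟨x, hx⟩).trans ?_
  simp [hp]

theorem faceProj_faceProj (x : A) :
    faceProj 𝒜 T h0 hT (faceProj 𝒜 T h0 hT x) = faceProj 𝒜 T h0 hT x := by
  induction x using DirectSum.Decomposition.inductionOn 𝒜 with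
  | zero => simp
  | @homogeneous i m =>
    by_cases h : T i
    · rw [faceProj_of_mem 𝒜 h0 hT h m.2, faceProj_of_mem 𝒜 h0 hT h m.2]
    · rw [faceProj_of_mem_not 𝒜 h0 hT h m.2, map_zero]
  | add m m' hm hm' => simp only [map_add, hm, hm']

theorem proj_faceProj (x : A) (p : ι) (hp : T p) :
    GradedAlgebra.proj 𝒜 p (faceProj 𝒜 T h0 hT x) = GradedAlgebra.proj 𝒜 p x := by
  induction x using DirectSum.Decomposition.inductionOn 𝒜 with
  | zero => simp
  | @homogeneous i m =>
    by_cases h : T i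
    · rw [faceProj_of_mem 𝒜 h0 hT h m.2]
    · rw [faceProj_of_mem_not 𝒜 h0 hT h m.2, map_zero, GradedAlgebra.proj_apply,
        DirectSum.decompose_of_mem_ne _ m.2]
      rintro rfl
      exact h hp
  | add m m' hm hm' => simp only [map_add, hm, hm']

variable {𝒜}

theorem ConnectedBy.eq_zero_of_mem_irrelevant {ω : ι →+ ℤ} (hA : ConnectedBy 𝒜 ω) {x : A}
    (hx : x ∈ irrelevant 𝒜) (hx0 : x ∈ 𝒜 0) : x = 0 := by
  have hT : ∀ p q, 𝒜 p = ⊥ ∨ 𝒜 q = ⊥ ∨ (p + q = 0 ↔ p = 0 ∧ q = 0) := by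
    intro p q
    by_contra! h
    obtain ⟨h1, h2, h3⟩ := h
    have hp : 0 ≤ ω p := by
      by_contra! h; exact h1 (hA.eq_bot_of_neg _ h)
    have hq : 0 ≤ ω q := by
      by_contra! h; exact h2 (hA.eq_bot_of_neg _ h)
    rcases h3 with ⟨h4, h5⟩ | ⟨h4, h5, h6⟩
    · have h6 : ω p + ω q = 0 := by rw [← map_add, h4, map_zero]
      have hp0 : p = 0 := by
        by_contra h; exact h1 (hA.eq_bot_of_zero _ (by lia) h)
      exact h5 hp0 (by rwa [hp0, zero_add] at h4)
    · exact h4 (by rw [h5, h6, add_zero])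
  have : irrelevant 𝒜 ≤ RingHom.ker (faceProj 𝒜 (fun p => p = 0) rfl hT) := by
    refine Ideal.span_le.mpr ?_
    rintro y ⟨i, hi, hy⟩
    exact faceProj_of_mem_not 𝒜 (T := fun p => p = 0) rfl hT hi hy
  rw [← faceProj_of_mem 𝒜 (T := fun p => p = 0) rfl hT rfl hx0]
  exact this hx

theorem exists_mem_zero_mk_eq (y : A ⧸ irrelevant 𝒜) :
    ∃ x ∈ 𝒜 0, Ideal.Quotient.mk (irrelevant 𝒜) x = y := by
  obtain ⟨a, rfl⟩ := Ideal.Quotient.mk_surjective y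
  induction a using DirectSum.Decomposition.inductionOn 𝒜 with
  | zero => exact ⟨0, zero_mem _, rfl⟩
  | @homogeneous i m =>
    by_cases h : i = 0
    · subst h; exact ⟨m, m.2, rfl⟩
    · exact ⟨0, zero_mem _, by
        rw [map_zero, eq_comm, Ideal.Quotient.eq_zero_iff_mem]
        exact Ideal.subset_span ⟨i, h, m.2⟩⟩
  | add m m' hm hm' =>
    obtain ⟨x, hx, hxm⟩ := hm
    obtain ⟨y, hy, hym⟩ := hm'
    exact ⟨x + y, add_mem hx hy, by rw [map_add, map_add, hxm, hym]⟩

theorem residueGrading_eq_bot {j : ι} (h : j ≠ 0) : residueGrading K A 𝒜 j = ⊥ := by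
  rw [residueGrading, if_neg h]

theorem mk_mem_residueGrading {j : ι} {x : A} (hx : x ∈ 𝒜 j) :
    Ideal.Quotient.mk (irrelevant 𝒜) x ∈ residueGrading K A 𝒜 j := by
  by_cases h : j = 0
  · rw [residueGrading, if_pos h]; trivial
  · rw [residueGrading, if_neg h, Submodule.mem_bot, Ideal.Quotient.eq_zero_iff_mem]
    exact Ideal.subset_span ⟨j, h, hx⟩

theorem exists_mem_mk_eq {j : ι} {y : A ⧸ irrelevant 𝒜} (hy : y ∈ residueGrading K A 𝒜 j) :
    ∃ x ∈ 𝒜 j, Ideal.Quotient.mk (irrelevant 𝒜) x = y := by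
  by_cases h : j = 0
  · subst h; exact exists_mem_zero_mk_eq y
  · rw [residueGrading_eq_bot h, Submodule.mem_bot] at hy
    exact ⟨0, zero_mem _, by rw [map_zero, hy]⟩

theorem gradedCompat_residueGrading : GradedCompat 𝒜 (residueGrading K A 𝒜) := by
  intro p q a m ha hm
  obtain ⟨x, hx, rfl⟩ := exists_mem_mk_eq hm
  exact mk_mem_residueGrading (SetLike.mul_mem_graded ha hx)

theorem ConnectedBy.nonempty_zero {ω : ι →+ ℤ} [Nontrivial A] (hA : ConnectedBy 𝒜 ω)
    {D : ℕ → Set ι} (Q : HomogeneousResolution 𝒜 (A ⧸ irrelevant 𝒜) (residueGrading K A 𝒜) D) :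
    Nonempty (Q.σ 0) := by
  by_contra h
  rw [not_nonempty_iff] at h
  obtain ⟨f, -, hf⟩ := Q.aug_surj 0 (Ideal.Quotient.mk (irrelevant 𝒜) 1)
    (mk_mem_residueGrading SetLike.GradedOne.one_mem)
  rw [Subsingleton.elim f 0, map_zero, eq_comm, Ideal.Quotient.eq_zero_iff_mem] at hf
  exact one_ne_zero (hA.eq_zero_of_mem_irrelevant hf SetLike.GradedOne.one_mem)

/-- The residue field of a connected `ℤ`-graded algebra has a free resolution whose higher
generators have positive degrees. -/
theorem ConnectedBy.exists_resolution {𝒜 : ℤ → Submodule K A} [GradedAlgebra 𝒜]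
    (hA : ConnectedBy 𝒜 (AddMonoidHom.id ℤ)) :
    Nonempty (HomogeneousResolution 𝒜 (A ⧸ irrelevant 𝒜) (residueGrading K A 𝒜)
      fun s => {j | (s = 0 ∧ j = 0) ∨ (s ≠ 0 ∧ 0 < j)}) := by
  classical
  refine exists_homogeneousResolution
    (fun s X => GradedCompat 𝒜 X.ℒ ∧ ∀ j ≤ 0, X.ℒ j = ⊥) ?_ ?_
  · have hlc : ∀ f : Unit →₀ A, Finsupp.linearCombination A
        (fun _ : Unit => Ideal.Quotient.mk (irrelevant 𝒜) 1) f =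
        Ideal.Quotient.mk (irrelevant 𝒜) (f ()) := by
      intro f
      rw [Finsupp.linearCombination_unique]
      rw [← mul_one (f ())]
      simp [Algebra.smul_def]
    refine ⟨Unit, fun _ => 0, Finsupp.linearCombination A
      (fun _ => Ideal.Quotient.mk (irrelevant 𝒜) 1), ?_, ?_, ?_, ?_, ?_⟩
    · simp
    · intro j f hf
      rw [hlc]
      have := hf ()
      rw [sub_zero] at this
      exact mk_mem_residueGrading this
    · intro j m hm
      obtain ⟨x, hx, rfl⟩ := exists_mem_mk_eq hm
      refine ⟨Finsupp.single () x, fun _ => by simpa using hx, ?_⟩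
      rw [hlc, Finsupp.single_eq_same]
    · exact (gradedCompat_free 𝒜 _).ker _
    · intro j hj
      rw [eq_bot_iff]
      intro f hf
      obtain ⟨hf, hf0⟩ : f ∈ freeGrading 𝒜 _ j ∧ Finsupp.linearCombination A _ f = 0 := hf
      rw [hlc, Ideal.Quotient.eq_zero_iff_mem] at hf0
      have hf := hf ()
      rw [sub_zero] at hf
      rw [Submodule.mem_bot]
      ext
      rcases hj.lt_or_eq with h | rfl
      · rwa [hA.eq_bot_of_neg _ h, Submodule.mem_bot] at hf
      · exact hA.eq_zero_of_mem_irrelevant hf0 hf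
  · rintro s X ⟨hc, hX⟩
    let τ := Σ j : {j : ℤ // 0 < j}, X.ℒ j
    let deg : τ → ℤ := fun t => t.1
    let g : τ → (X.σ →₀ A) := fun t => t.2
    refine ⟨τ, deg, Finsupp.linearCombination A g, ?_, ?_, ?_, ?_, ?_⟩
    · rintro ⟨⟨j, hj⟩, t⟩
      exact Or.inr ⟨by simp, hj⟩
    · intro j f hf
      exact linearCombination_mem hc (fun t => t.2.2) hf
    · intro j m hm
      by_cases hj : 0 < j
      · exact ⟨Finsupp.single ⟨⟨j, hj⟩, ⟨m, hm⟩⟩ 1,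
          single_mem_freeGrading deg ⟨⟨j, hj⟩, ⟨m, hm⟩⟩, by simp [g]⟩
      · rw [hX j (by lia), Submodule.mem_bot] at hm
        exact ⟨0, zero_mem _, by rw [hm, map_zero]⟩
    · exact (gradedCompat_free 𝒜 _).ker _
    · intro j hj
      rw [eq_bot_iff]
      intro f hf
      have hf : f ∈ freeGrading 𝒜 deg j := hf.1
      rw [Submodule.mem_bot]
      ext t
      have h1 := hf t
      have h2 : 0 < deg t := t.1.2
      rwa [hA.eq_bot_of_neg _ (by simp only [AddMonoidHom.id_apply]; lia),
        Submodule.mem_bot] at h1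

end ResidueField

section Retract

variable {R S V 𝒮 : Type} [CommRing R] [CommRing S] [Algebra R S] [AddCommGroup V] [Module R V]

/-- Construction of a null homotopy on a bounded below complex of free modules. -/
theorem exists_nullHomotopy (lev : 𝒮 → ℕ) (D : (𝒮 →₀ R) →ₗ[R] (𝒮 →₀ R))
    (aug : (𝒮 →₀ R) →ₗ[R] V) (hlev : ∀ x y, D (Finsupp.single x 1) y ≠ 0 → lev y < lev x)
    (hDD : D ∘ₗ D = 0) (hex : ∀ z, D z = 0 → aug z = 0 → ∃ w, aug w = 0 ∧ D w = z)
    (ε : R) (g : (𝒮 →₀ R) →ₗ[R] (𝒮 →₀ R)) (hg : ∀ z, D (g z) = ε • g (D z))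
    (hga : ∀ z, aug (g z) = 0) :
    ∃ h : (𝒮 →₀ R) →ₗ[R] (𝒮 →₀ R), (∀ z, aug (h z) = 0) ∧
      ∀ z, D (h z) = g z - ε • h (D z) := by
  classical
  let choice : (𝒮 →₀ R) → (𝒮 →₀ R) := fun z =>
    if h : ∃ w, aug w = 0 ∧ D w = z then h.choose else 0
  have hchoice : ∀ z, D z = 0 → aug z = 0 → aug (choice z) = 0 ∧ D (choice z) = z := by
    intro z h1 h2
    have h := hex z h1 h2
    simp only [choice, dif_pos h]
    exact h.choose_spec
  have hwf : WellFounded (fun x y => lev x < lev y) := (measure lev).wf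
  let H : 𝒮 → (𝒮 →₀ R) := hwf.fix fun x IH => choice (g (Finsupp.single x 1) -
    ε • Finsupp.linearCombination R (fun y => if hy : lev y < lev x then IH y hy else 0)
      (D (Finsupp.single x 1)))
  let h := Finsupp.linearCombination R H
  have hH : ∀ x, H x = choice (g (Finsupp.single x 1) - ε • h (D (Finsupp.single x 1))) := by
    intro x
    change hwf.fix _ x = _
    rw [hwf.fix_eq]
    congr 3
    rw [Finsupp.linearCombination_apply, Finsupp.linearCombination_apply]
    refine Finset.sum_congr rfl fun y hy => ?_
    simp only []
    rw [dif_pos (hlev x y (Finsupp.mem_support_iff.mp hy))]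
  have key : ∀ n x, lev x = n → aug (H x) = 0 ∧
      D (H x) = g (Finsupp.single x 1) - ε • h (D (Finsupp.single x 1)) := by
    intro n
    induction n using Nat.strong_induction_on with
    | _ n ih =>
    rintro x rfl
    have h1 : ∀ y ∈ (D (Finsupp.single x 1)).support, aug (H y) = 0 ∧
        D (H y) = g (Finsupp.single y 1) - ε • h (D (Finsupp.single y 1)) := fun y hy =>
      ih _ (hlev x y (Finsupp.mem_support_iff.mp hy)) y rfl
    have hsum : ∀ u : 𝒮 →₀ R, u = ∑ y ∈ u.support, u y • Finsupp.single y (1 : R) := by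
      intro u
      conv_lhs => rw [← Finsupp.sum_single u]
      exact Finset.sum_congr rfl fun y _ => by simp
    have h2 : aug (h (D (Finsupp.single x 1))) = 0 := by
      rw [Finsupp.linearCombination_apply, Finsupp.sum, map_sum]
      exact Finset.sum_eq_zero fun y hy => by rw [map_smul, (h1 y hy).1, smul_zero]
    have h3 : D (h (D (Finsupp.single x 1))) = g (D (Finsupp.single x 1)) := by
      have h4 : g (D (Finsupp.single x 1)) - ε • h (D (D (Finsupp.single x 1))) =
          g (D (Finsupp.single x 1)) := by
        rw [show D (D (Finsupp.single x 1)) = 0 from LinearMap.congr_fun hDD _, map_zero,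
          smul_zero, sub_zero]
      rw [← h4]
      set u := D (Finsupp.single x 1)
      have h5 : g u - ε • h (D u) = (g - ε • h ∘ₗ D) u := rfl
      rw [h5]
      conv_rhs => rw [hsum u]
      rw [map_sum, Finsupp.linearCombination_apply, Finsupp.sum, map_sum]
      refine Finset.sum_congr rfl fun y hy => ?_
      rw [map_smul, map_smul, (h1 y hy).2]
      rfl
    rw [hH]
    refine hchoice _ ?_ ?_
    · rw [map_sub, map_smul, h3, hg, sub_self]
    · rw [map_sub, map_smul, hga, h2, smul_zero, sub_zero]
  have h1 : ∀ x, h (Finsupp.single x 1) = H x := fun x => by simp [h]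
  refine ⟨h, fun z => ?_, fun z => ?_⟩
  · have : aug ∘ₗ h = 0 := by
      ext x
      simpa [h] using (key _ x rfl).1
    exact LinearMap.congr_fun this z
  · have : D ∘ₗ h = g - ε • (h ∘ₗ D) := by
      ext1 x
      refine LinearMap.ext_ring ?_
      change D (h (Finsupp.single x 1)) = _
      rw [h1]
      exact (key _ x rfl).2
    exact LinearMap.congr_fun this z

variable (ι : S →+* R)

/-- The `S`-linear combination, via `ι : S → R`, of endomorphisms of an `R`-module. -/
noncomputable def twist {W τ : Type} [AddCommGroup W] [Module R W] (h : τ → W) : (τ →₀ S) →+ W :=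
  (Finsupp.linearCombination R h).toAddMonoidHom.comp
    (Finsupp.mapRange.addMonoidHom ι.toAddMonoidHom)

theorem twist_single {W τ : Type} [AddCommGroup W] [Module R W] (h : τ → W) (t : τ) (s : S) :
    twist ι h (Finsupp.single t s) = ι s • h t := by
  simp [twist]

theorem map_twist {W W' τ : Type} [AddCommGroup W] [Module R W] [AddCommGroup W'] [Module R W']
    (f : W →ₗ[R] W') (h : τ → W) (c : τ →₀ S) :
    f (twist ι h c) = twist ι (fun t => f (h t)) c := by
  induction c using Finsupp.induction_linear with
  | zero => simp
  | add f g hf hg => simp only [map_add, hf, hg]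
  | single t s => simp [twist_single]

theorem twist_twist {W τ τ' : Type} [AddCommGroup W] [Module R W] (h : τ → W)
    (f : τ' → (τ →₀ S)) (c : τ' →₀ S) :
    twist ι (fun t => twist ι h (f t)) c = twist ι h (Finsupp.linearCombination S f c) := by
  have hsmul : ∀ (s : S) (c : τ →₀ S), twist ι h (s • c) = ι s • twist ι h c := by
    intro s c
    induction c using Finsupp.induction_linear with
    | zero => simp
    | add f g hf hg => rw [smul_add, map_add, map_add, smul_add, hf, hg]
    | single t r =>
      rw [show s • Finsupp.single t r = Finsupp.single t (s * r) from Finsupp.smul_single s t r,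
        twist_single, twist_single, map_mul, mul_smul]
  induction c using Finsupp.induction_linear with
  | zero => simp
  | add f g hf hg => simp only [map_add, hf, hg]
  | single t s => rw [twist_single, Finsupp.linearCombination_single, hsmul]

/-- The map on `S`-coefficients induced by a family of endomorphisms of a free `R`-module. -/
noncomputable def twistMap {τ : Type} (h : τ → ((𝒮 →₀ R) →ₗ[R] (𝒮 →₀ R))) :
    (𝒮 →₀ (τ →₀ S)) →ₗ[R] (𝒮 →₀ S) :=
  Finsupp.lsum ℕ fun x => Finsupp.lsum ℕ fun a => outer S 𝒮 (h a (Finsupp.single x 1))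

theorem twistMap_single {τ : Type} (h : τ → ((𝒮 →₀ R) →ₗ[R] (𝒮 →₀ R))) (x : 𝒮) (c : τ →₀ S) :
    twistMap h (Finsupp.single x c) =
      Finsupp.lsum ℕ (fun a => outer S 𝒮 (h a (Finsupp.single x 1))) c := by
  rw [twistMap, Finsupp.lsum_single]

theorem twistMap_outer {τ : Type} (h : τ → ((𝒮 →₀ R) →ₗ[R] (𝒮 →₀ R))) (f : 𝒮 →₀ R)
    (a : τ) (s : S) :
    twistMap h (outer (τ →₀ S) 𝒮 f (Finsupp.single a s)) = outer S 𝒮 (h a f) s := by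
  induction f using Finsupp.induction_linear with
  | zero => simp
  | add f g hf hg => simp only [map_add, LinearMap.add_apply, hf, hg]
  | single x r =>
    have hx : Finsupp.single x r = r • Finsupp.single x (1 : R) := by simp
    rw [outer_single, twistMap_single, Finsupp.smul_single, hx, Finsupp.lsum_single,
      map_smul (h a), map_smul (outer S 𝒮), LinearMap.smul_apply, map_smul]

theorem outer_twist (hι : ∀ s, algebraMap R S (ι s) = s) {τ : Type}
    (h : τ → ((𝒮 →₀ R) →ₗ[R] (𝒮 →₀ R))) (c : τ →₀ S) (x : 𝒮) (s : S) :
    outer S 𝒮 (twist ι h c (Finsupp.single x 1)) s =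
      twistMap h (Finsupp.single x (s • c)) := by
  rw [twistMap_single]
  induction c using Finsupp.induction_linear with
  | zero => simp
  | add f g hf hg => simp only [map_add, LinearMap.add_apply, smul_add, hf, hg]
  | single a r =>
    rw [twist_single, LinearMap.smul_apply, map_smul, LinearMap.smul_apply, ← map_smul,
      Algebra.smul_def, hι, show s • Finsupp.single a r = Finsupp.single a (s * r) from
        Finsupp.smul_single s a r, Finsupp.lsum_single, mul_comm]

theorem tens_twistMap (hι : ∀ s, algebraMap R S (ι s) = s) (D : (𝒮 →₀ R) →ₗ[R] (𝒮 →₀ R))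
    (ε : R) {τ τ' : Type} (h : τ → ((𝒮 →₀ R) →ₗ[R] (𝒮 →₀ R)))
    (h' : τ' → ((𝒮 →₀ R) →ₗ[R] (𝒮 →₀ R))) (f : τ' → (τ →₀ S))
    (hh : ∀ a z, D (h' a z) = twist ι h (f a) z - ε • h' a (D z)) (w : 𝒮 →₀ (τ' →₀ S)) :
    tens S D (twistMap h' w) = twistMap h (Finsupp.mapRange.linearMap
      ((Finsupp.linearCombination S f).restrictScalars R) w) -
        ε • twistMap h' (tens (τ' →₀ S) D w) := by
  induction w using Finsupp.induction_linear with
  | zero => simp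
  | add f g hf hg => simp only [map_add, hf, hg, smul_add]; abel
  | single x c =>
    induction c using Finsupp.induction_linear with
    | zero => simp
    | add f g hf hg => simp only [Finsupp.single_add, map_add, hf, hg, smul_add]; abel
    | single a s =>
      rw [twistMap_single, Finsupp.lsum_single, tens_outer, hh, tens_single, twistMap_outer,
        map_sub, LinearMap.sub_apply, outer_twist ι hι, map_smul, LinearMap.smul_apply]
      simp

/-- Let `S` be an algebra retract of `R` and `F` a free resolution of an `R`-module `V` killed
by an ideal `𝔫` of `S`. Then cycles of `S ⊗ F` with coefficients in `𝔫` are boundaries. -/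
theorem exists_boundary_of_retract (hι : ∀ s, algebraMap R S (ι s) = s)
    (lev : 𝒮 → ℕ) (D : (𝒮 →₀ R) →ₗ[R] (𝒮 →₀ R))
    (aug : (𝒮 →₀ R) →ₗ[R] V) (hlev : ∀ x y, D (Finsupp.single x 1) y ≠ 0 → lev y < lev x)
    (hDD : D ∘ₗ D = 0) (hex : ∀ z, D z = 0 → aug z = 0 → ∃ w, aug w = 0 ∧ D w = z)
    (n : ℕ) : ∀ (τ : Type) (h : τ → ((𝒮 →₀ R) →ₗ[R] (𝒮 →₀ R))) (ε : R)
      (N : Submodule S (τ →₀ S)),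
      (∀ c ∈ N, (∀ z, D (twist ι h c z) = ε • twist ι h c (D z)) ∧
        ∀ z, aug (twist ι h c z) = 0) →
      ∀ u : 𝒮 →₀ (τ →₀ S), (∀ x, u x ∈ N) → (∀ x, u x ≠ 0 → lev x < n) →
        tens (τ →₀ S) D u = 0 → ∃ v, tens S D v = twistMap h u := by
  classical
  induction n with
  | zero =>
    intro τ h ε N _ u _ hu _
    have : u = 0 := by
      ext1 x
      by_contra hx
      exact absurd (hu x hx) (by simp)
    exact ⟨0, by rw [this, map_zero, map_zero]⟩
  | succ n ih =>
    intro τ h ε N hN u huN hu hu0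
    choose h' haug' hh' using fun c : N => exists_nullHomotopy lev D aug hlev hDD hex ε
      (twist ι h c) (hN c c.2).1 (hN c c.2).2
    let f : N → (τ →₀ S) := fun c => c
    let w : 𝒮 →₀ (N →₀ S) := Finsupp.mapRange (fun c => if hc : c ∈ N ∧ c ≠ 0 then
      Finsupp.single (⟨c, hc.1⟩ : N) (1 : S) else 0) (by simp) u
    have hw : Finsupp.mapRange.linearMap
        ((Finsupp.linearCombination S f).restrictScalars R) w = u := by
      ext1 x
      simp only [w, Finsupp.mapRange.linearMap_apply, Finsupp.mapRange_apply]
      split_ifs with hx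
      · simp [f]
      · have : u x = 0 := by
          by_contra h0; exact hx ⟨huN x, h0⟩
        simp [this]
    have hwx : ∀ x, w x ≠ 0 → lev x < n + 1 := by
      intro x hx
      refine hu x fun h0 => hx ?_
      simp [w, h0]
    obtain ⟨v, hv⟩ := ih N h' (-ε) (LinearMap.ker (Finsupp.linearCombination S f)) (by
        intro c hc
        have ht : ∀ z, twist ι h' c z = twist ι (fun a => h' a z) c := fun z =>
          map_twist ι (LinearMap.applyₗ z) h' c
        refine ⟨fun z => ?_, fun z => ?_⟩
        · have h1 : twist ι (fun a => twist ι h (f a)) c = 0 := by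
            rw [twist_twist, LinearMap.mem_ker.mp hc, map_zero]
          have h2 : D (twist ι h' c z) = (twist ι (fun a => twist ι h (f a)) c) z -
              ε • twist ι h' c (D z) := by
            rw [ht, ht, map_twist]
            clear hc h1 ht
            induction c using Finsupp.induction_linear with
            | zero => simp
            | add f g hf hg =>
              simp only [map_add, hf, hg, smul_add, LinearMap.add_apply]; abel
            | single a s =>
              rw [twist_single, twist_single, twist_single, hh', smul_sub, smul_comm]
              rfl
          rw [h2, h1, LinearMap.zero_apply, zero_sub, neg_smul]
        · rw [ht, map_twist]
          simp only [haug']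
          clear hc ht
          induction c using Finsupp.induction_linear with
          | zero => simp
          | add f g hf hg => rw [map_add, hf, hg, add_zero]
          | single a s => rw [twist_single, smul_zero])
      (tens (N →₀ S) D w)
      (by
        intro x
        have h1 := mapRange_tens ((Finsupp.linearCombination S f).restrictScalars R) D w
        rw [hw, hu0] at h1
        simpa using DFunLike.congr_fun h1 x)
      (by
        intro x hx
        by_contra hlx
        refine hx ?_
        rw [tens, Finsupp.lsum_apply, Finsupp.sum, Finsupp.finsetSum_apply]
        refine Finset.sum_eq_zero fun y hy => ?_
        rw [outer_apply]
        have h1 : D (Finsupp.single y 1) x = 0 := by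
          by_contra h0
          have := hlev y x h0
          have := hwx y (Finsupp.mem_support_iff.mp hy)
          lia
        rw [h1, zero_smul])
      (by rw [tens_tens, hDD, tens_zero])
    refine ⟨twistMap h' w + ε • v, ?_⟩
    rw [map_add, map_smul, hv, tens_twistMap ι hι D ε h h' f hh', hw, sub_add_cancel]

end Retract

section TotalComplex

variable {R V : Type} [CommRing R] [AddCommGroup V] [Module R V] {σ : ℕ → Type}

/-- The inclusion of the `n`-th summand in `⨁ₙ (σ n →₀ M)`. -/
noncomputable def totalIncl (R : Type) [CommRing R] (σ : ℕ → Type) (M : Type) [AddCommGroup M]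
    [Module R M] (n : ℕ) : (σ n →₀ M) →ₗ[R] ((Σ n, σ n) →₀ M) :=
  Finsupp.lmapDomain M R (Sigma.mk n)

/-- The projection onto the `n`-th summand of `⨁ₙ (σ n →₀ M)`. -/
noncomputable def totalProj (R : Type) [CommRing R] (σ : ℕ → Type) (M : Type) [AddCommGroup M]
    [Module R M] (n : ℕ) : ((Σ n, σ n) →₀ M) →ₗ[R] (σ n →₀ M) :=
  Finsupp.lcomapDomain (Sigma.mk n) sigma_mk_injective

variable {M : Type} [AddCommGroup M] [Module R M]

theorem totalProj_apply (n : ℕ) (z : (Σ n, σ n) →₀ M) (t : σ n) :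
    totalProj R σ M n z t = z ⟨n, t⟩ := rfl

theorem totalIncl_single (n : ℕ) (t : σ n) (m : M) :
    totalIncl R σ M n (Finsupp.single t m) = Finsupp.single ⟨n, t⟩ m :=
  Finsupp.mapDomain_single

theorem totalIncl_apply_of_ne {n : ℕ} (z : σ n →₀ M) {x : Σ n, σ n} (hx : x.1 ≠ n) :
    totalIncl R σ M n z x = 0 :=
  Finsupp.mapDomain_of_notMem_range _ _ (by rintro ⟨t, rfl⟩; exact hx rfl)

theorem totalIncl_apply_mk {n : ℕ} (z : σ n →₀ M) (t : σ n) :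
    totalIncl R σ M n z ⟨n, t⟩ = z t :=
  Finsupp.mapDomain_apply sigma_mk_injective _ _

theorem totalProj_totalIncl (n : ℕ) (z : σ n →₀ M) :
    totalProj R σ M n (totalIncl R σ M n z) = z := by
  ext t
  rw [totalProj_apply, totalIncl_apply_mk]

theorem totalProj_totalIncl_of_ne {m n : ℕ} (h : m ≠ n) (z : σ n →₀ M) :
    totalProj R σ M m (totalIncl R σ M n z) = 0 := by
  ext t
  rw [totalProj_apply, totalIncl_apply_of_ne z h, Finsupp.zero_apply]

theorem sum_totalIncl_totalProj (z : (Σ n, σ n) →₀ M) [DecidableEq ℕ] :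
    ∑ n ∈ z.support.image Sigma.fst, totalIncl R σ M n (totalProj R σ M n z) = z := by
  ext ⟨k, t⟩
  rw [Finsupp.finsetSum_apply]
  by_cases hk : k ∈ z.support.image Sigma.fst
  · rw [Finset.sum_eq_single_of_mem k hk fun n _ hn => totalIncl_apply_of_ne _ hn.symm,
      totalIncl_apply_mk, totalProj_apply]
  · have hz : z ⟨k, t⟩ = 0 := by
      by_contra h
      exact hk (Finset.mem_image_of_mem Sigma.fst (Finsupp.mem_support_iff.mpr h))
    rw [hz]
    exact Finset.sum_eq_zero fun n hn => totalIncl_apply_of_ne _ fun h =>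
      hk ((show k = n from h) ▸ hn)

variable (d : (s : ℕ) → ((σ (s + 1) →₀ R) →ₗ[R] (σ s →₀ R)))

/-- The images of the basis elements under the differential of a total complex. -/
noncomputable def totalDiffBasis : (Σ n, σ n) → ((Σ n, σ n) →₀ R)
  | ⟨0, _⟩ => 0
  | ⟨n + 1, t⟩ => totalIncl R σ R n (d n (Finsupp.single t 1))

/-- The differential of a complex of free modules, on the sum of all its terms. -/
noncomputable def totalDiff : ((Σ n, σ n) →₀ R) →ₗ[R] ((Σ n, σ n) →₀ R) :=
  Finsupp.linearCombination R (totalDiffBasis d)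

theorem totalDiff_single (x : Σ n, σ n) :
    totalDiff d (Finsupp.single x 1) = totalDiffBasis d x := by
  rw [totalDiff, Finsupp.linearCombination_single, one_smul]

theorem outer_totalIncl (n : ℕ) (f : σ n →₀ R) (m : M) :
    outer M _ (totalIncl R σ R n f) m = totalIncl R σ M n (outer M _ f m) := by
  induction f using Finsupp.induction_linear with
  | zero => simp
  | add f g hf hg => simp only [map_add, LinearMap.add_apply, hf, hg]
  | single t r => rw [totalIncl_single, outer_single, outer_single, totalIncl_single]

theorem tens_totalDiff_zero (z : σ 0 →₀ M) :
    tens M (totalDiff d) (totalIncl R σ M 0 z) = 0 := by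
  induction z using Finsupp.induction_linear with
  | zero => simp
  | add f g hf hg => rw [map_add, map_add, hf, hg, add_zero]
  | single t m =>
    rw [totalIncl_single, tens_single, totalDiff_single]
    simp [totalDiffBasis]

theorem tens_totalDiff_succ (n : ℕ) (z : σ (n + 1) →₀ M) :
    tens M (totalDiff d) (totalIncl R σ M (n + 1) z) = totalIncl R σ M n (tens M (d n) z) := by
  induction z using Finsupp.induction_linear with
  | zero => simp
  | add f g hf hg => simp only [map_add, hf, hg]
  | single t m =>
    rw [totalIncl_single, tens_single, totalDiff_single, tens_single, ← outer_totalIncl]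
    rfl

theorem totalProj_tens (n : ℕ) (z : (Σ n, σ n) →₀ M) :
    totalProj R σ M n (tens M (totalDiff d) z) = tens M (d n) (totalProj R σ M (n + 1) z) := by
  induction z using Finsupp.induction_linear with
  | zero => simp
  | add f g hf hg => simp only [map_add, hf, hg]
  | single x m =>
    obtain ⟨k, t⟩ := x
    rw [← totalIncl_single (R := R)]
    cases k with
    | zero =>
      rw [tens_totalDiff_zero, totalProj_totalIncl_of_ne (by lia), map_zero, map_zero]
    | succ k =>
      rw [tens_totalDiff_succ]
      by_cases h : n = k
      · subst h
        rw [totalProj_totalIncl, totalProj_totalIncl]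
      · rw [totalProj_totalIncl_of_ne h, totalProj_totalIncl_of_ne (by lia), map_zero]

variable {S : Type} [CommRing S] [Algebra R S] (ι : S →+* R)

/-- Let `S` be an algebra retract of `R` and `𝔫` an ideal of `S` which annihilates the module
resolved by the complex `d`.  Cycles of `S ⊗ d` with coefficients in `𝔫` are boundaries. -/
theorem exists_tens_eq_of_retract (hι : ∀ s, algebraMap R S (ι s) = s)
    (aug : (σ 0 →₀ R) →ₗ[R] V) (hzero : LinearMap.range (d 0) = LinearMap.ker aug)
    (hsucc : ∀ s, LinearMap.range (d (s + 1)) = LinearMap.ker (d s))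
    (𝔫 : Ideal S) (h𝔫 : ∀ c ∈ 𝔫, ∀ v : V, ι c • v = 0) (i : ℕ) (z : σ i →₀ S)
    (hz : ∀ t, z t ∈ 𝔫) (hzc : ∀ k (h : i = k + 1), tens S (d k) (h ▸ z) = 0) :
    ∃ w, tens S (d i) w = z := by
  classical
  have hdd : ∀ s x, d s (d (s + 1) x) = 0 := fun s x =>
    LinearMap.mem_ker.mp (hsucc s ▸ LinearMap.mem_range_self _ x)
  have hD0 : ∀ z, totalDiff d (totalIncl R σ R 0 z) = 0 := fun z => by
    rw [← tens_self, tens_totalDiff_zero]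
  have hDs : ∀ n z, totalDiff d (totalIncl R σ R (n + 1) z) = totalIncl R σ R n (d n z) :=
    fun n z => by rw [← tens_self, tens_totalDiff_succ, tens_self]
  have hDp : ∀ n z, totalProj R σ R n (totalDiff d z) = d n (totalProj R σ R (n + 1) z) :=
    fun n z => by rw [← tens_self (totalDiff d), totalProj_tens, tens_self]
  have hlev : ∀ x y : Σ n, σ n, totalDiff d (Finsupp.single x 1) y ≠ 0 → y.1 < x.1 := by
    rintro ⟨_ | n, t⟩ y hy
    · rw [totalDiff_single] at hy
      exact absurd rfl hy
    · rw [totalDiff_single] at hy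
      have : y.1 = n := by
        by_contra h
        exact hy (totalIncl_apply_of_ne _ h)
      exact this ▸ Nat.lt_succ_self _
  have hDD : totalDiff d ∘ₗ totalDiff d = 0 := by
    ext1 ⟨n, t⟩
    refine LinearMap.ext_ring ?_
    change totalDiff d (totalDiff d (Finsupp.single ⟨n, t⟩ 1)) = 0
    rw [← totalIncl_single (R := R)]
    rcases n with _ | _ | n
    · rw [hD0, map_zero]
    · rw [hDs, hD0]
    · rw [hDs, hDs, hdd, map_zero]
  have hex : ∀ z, totalDiff d z = 0 → (aug ∘ₗ totalProj R σ R 0) z = 0 →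
      ∃ w, (aug ∘ₗ totalProj R σ R 0) w = 0 ∧ totalDiff d w = z := by
    intro z hz ha
    have hp : ∀ n, ∃ w, d n w = totalProj R σ R n z := by
      rintro (_ | n)
      · exact LinearMap.mem_range.mp (hzero ▸ ha)
      · refine LinearMap.mem_range.mp (hsucc n ▸ ?_)
        rw [LinearMap.mem_ker, ← hDp, hz, map_zero]
    choose w hw using hp
    refine ⟨∑ n ∈ z.support.image Sigma.fst, totalIncl R σ R (n + 1) (w n), ?_, ?_⟩
    · rw [map_sum]
      refine Finset.sum_eq_zero fun n _ => ?_
      rw [LinearMap.comp_apply, totalProj_totalIncl_of_ne (by lia), map_zero]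
    · rw [map_sum]
      conv_rhs => rw [← sum_totalIncl_totalProj (R := R) z]
      exact Finset.sum_congr rfl fun n _ => by rw [hDs, hw]
  let h : Unit → (((Σ n, σ n) →₀ R) →ₗ[R] ((Σ n, σ n) →₀ R)) := fun _ => LinearMap.id
  have htw : ∀ c : Unit →₀ S, twist ι h c = ι (c ()) • LinearMap.id := by
    intro c
    conv_lhs => rw [show c = Finsupp.single () (c ()) by ext; simp]
    rw [twist_single]
  let e : S →ₗ[R] (Unit →₀ S) := Finsupp.lsingle ()
  let u := Finsupp.mapRange.linearMap e (totalIncl R σ S i z)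
  have htu : twistMap h u = totalIncl R σ S i z := by
    have : ∀ y : (Σ n, σ n) →₀ S, twistMap h (Finsupp.mapRange.linearMap e y) = y := by
      intro y
      induction y using Finsupp.induction_linear with
      | zero => simp
      | add f g hf hg => simp only [map_add, hf, hg]
      | single x s =>
        rw [Finsupp.mapRange.linearMap_apply, Finsupp.mapRange_single, twistMap_single]
        change (Finsupp.lsum ℕ (fun a => outer S (Σ n, σ n) ((h a) (Finsupp.single x 1))))
          (Finsupp.single () s) = _
        rw [Finsupp.lsum_single]
        change outer S _ (Finsupp.single x 1) s = _
        rw [outer_single, one_smul]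
    exact this _
  have hzt : tens S (totalDiff d) (totalIncl R σ S i z) = 0 := by
    cases i with
    | zero => exact tens_totalDiff_zero d z
    | succ k => rw [tens_totalDiff_succ, show tens S (d k) z = 0 from hzc k rfl, map_zero]
  have hua : ∀ x, u x = Finsupp.single () (totalIncl R σ S i z x) := fun x => rfl
  obtain ⟨v, hv⟩ := exists_boundary_of_retract ι hι Sigma.fst (totalDiff d)
    (aug ∘ₗ totalProj R σ R 0) hlev hDD hex (i + 1) Unit h 1
    (Submodule.comap (Finsupp.lapply () : (Unit →₀ S) →ₗ[S] S) 𝔫)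
    (by
      intro c hc
      refine ⟨fun z => ?_, fun z => ?_⟩
      · rw [htw, one_smul, LinearMap.smul_apply, LinearMap.smul_apply, map_smul]
        rfl
      · rw [htw, LinearMap.smul_apply, map_smul]
        exact h𝔫 _ hc _)
    u
    (by
      rintro ⟨n, t⟩
      rw [hua]
      change Finsupp.single () _ () ∈ 𝔫
      rw [Finsupp.single_eq_same]
      by_cases hn : n = i
      · subst hn
        rw [totalIncl_apply_mk]; exact hz t
      · rw [totalIncl_apply_of_ne _ hn]; exact zero_mem _)
    (by
      intro x hx
      by_contra hn
      refine hx ?_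
      rw [hua, totalIncl_apply_of_ne _ (by lia), Finsupp.single_zero])
    (by rw [← mapRange_tens, hzt, map_zero])
  refine ⟨totalProj R σ S (i + 1) v, ?_⟩
  rw [← totalProj_tens, hv, htu, totalProj_totalIncl]

end TotalComplex

section Face

variable {K A ι : Type} [Field K] [CommRing A] [Algebra K A] [AddCommGroup ι] [DecidableEq ι]
  (𝒜 : ι → Submodule K A) [GradedAlgebra 𝒜] {T : ι → Prop} (h0 : T 0)
  (hT : ∀ p q, 𝒜 p = ⊥ ∨ 𝒜 q = ⊥ ∨ (T (p + q) ↔ T p ∧ T q))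

/-- The ideal of elements with no components in a face of the set of degrees. -/
noncomputable def faceIdeal : Ideal A := RingHom.ker (faceProj 𝒜 T h0 hT)

theorem mem_faceIdeal {x : A} : x ∈ faceIdeal 𝒜 h0 hT ↔ faceProj 𝒜 T h0 hT x = 0 := Iff.rfl

theorem proj_mem_faceIdeal {x : A} (hx : x ∈ faceIdeal 𝒜 h0 hT) (p : ι) :
    GradedAlgebra.proj 𝒜 p x ∈ faceIdeal 𝒜 h0 hT := by
  rw [mem_faceIdeal] at hx ⊢
  by_cases hp : T p
  · rw [← proj_faceProj 𝒜 h0 hT x p hp, hx, map_zero, map_zero]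
  · refine faceProj_of_mem_not 𝒜 h0 hT hp ?_
    rw [GradedAlgebra.proj_apply]
    exact SetLike.coe_mem _

open scoped Classical in
/-- The graded pieces outside of a face of the set of degrees. -/
noncomputable def offFace (T : ι → Prop) (j : ι) : Submodule K A := if T j then ⊥ else 𝒜 j

theorem kerGrading_faceIdeal :
    kerGrading 𝒜 (faceIdeal 𝒜 h0 hT).mkQ = offFace 𝒜 T := by
  ext j x
  rw [mem_kerGrading, Submodule.mkQ_apply, Submodule.Quotient.mk_eq_zero, mem_faceIdeal, offFace]
  by_cases hj : T j
  · rw [if_pos hj, Submodule.mem_bot]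
    constructor
    · rintro ⟨h1, h2⟩
      rwa [faceProj_of_mem 𝒜 h0 hT hj h1] at h2
    · rintro rfl
      exact ⟨zero_mem _, map_zero _⟩
  · rw [if_neg hj]
    exact ⟨And.left, fun h => ⟨h, faceProj_of_mem_not 𝒜 h0 hT hj h⟩⟩

/-- The grading of the quotient by a face ideal. -/
noncomputable def faceQuotientGrading (j : ι) : Submodule K (A ⧸ faceIdeal 𝒜 h0 hT) :=
  (𝒜 j).map ((faceIdeal 𝒜 h0 hT).mkQ.restrictScalars K)

/-- Linearity of the resolution of the residue field passes to a retract. -/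
theorem torVan_faceQuotientGrading {ω : ι →+ ℤ}
    (F : GradedFreeResolution K A 𝒜 (A ⧸ irrelevant 𝒜) (residueGrading K A 𝒜)
      fun s => {v | ω v = s}) {i : ℕ} {j : ι} (hij : i < ω j) :
    (F.toHomogeneous 𝒜).TorVan (faceQuotientGrading 𝒜 h0 hT) i j := by
  intro z hz hzc
  obtain ⟨z', hz', rfl⟩ := exists_lift_shiftGrading (ℳ := 𝒜) (g := (faceIdeal 𝒜 h0 hT).mkQ)
    (fun j n hn => by simpa [faceQuotientGrading] using hn) hz
  let e : (A ⧸ faceIdeal 𝒜 h0 hT) →+* A :=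
    Ideal.Quotient.lift _ (faceProj 𝒜 T h0 hT).toRingHom fun a ha => ha
  have he : ∀ x, e (Ideal.Quotient.mk _ x) = faceProj 𝒜 T h0 hT x := fun x => rfl
  have hι : ∀ s, algebraMap A (A ⧸ faceIdeal 𝒜 h0 hT) (e s) = s := by
    intro s
    obtain ⟨x, rfl⟩ := Ideal.Quotient.mk_surjective s
    rw [he]
    refine Ideal.Quotient.eq.mpr ?_
    rw [mem_faceIdeal, map_sub, faceProj_faceProj, sub_self]
  obtain ⟨w, hw⟩ := exists_tens_eq_of_retract F.d e hι F.aug F.exact_zero F.exact_succ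
    (Ideal.comap e (irrelevant 𝒜))
    (by
      intro c hc v
      obtain ⟨y, rfl⟩ := Ideal.Quotient.mk_surjective v
      change Ideal.Quotient.mk _ (e c * y) = 0
      exact Ideal.Quotient.eq_zero_iff_mem.mpr (Ideal.mul_mem_right _ _ hc))
    i (Finsupp.mapRange.linearMap (faceIdeal 𝒜 h0 hT).mkQ z')
    (by
      intro t
      change e (Ideal.Quotient.mk _ (z' t)) ∈ irrelevant 𝒜
      have ht : ω (F.deg i t) = i := F.deg_mem i t
      rw [he]
      have h1 : z' t ∈ 𝒜 (j - F.deg i t) := hz' t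
      by_cases hp : T (j - F.deg i t)
      · rw [faceProj_of_mem 𝒜 h0 hT hp h1]
        refine Ideal.subset_span ⟨_, fun h => ?_, h1⟩
        have := congrArg ω h
        rw [map_sub, map_zero] at this
        lia
      · rw [faceProj_of_mem_not 𝒜 h0 hT hp h1]
        exact zero_mem _)
    (by rintro k rfl; exact hzc)
  obtain ⟨w', rfl⟩ := Finsupp.mapRange_surjective (faceIdeal 𝒜 h0 hT).mkQ (map_zero _)
    (Submodule.mkQ_surjective _) w
  change tens _ (F.d i) (Finsupp.mapRange.linearMap (faceIdeal 𝒜 h0 hT).mkQ w') = _ at hw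
  rw [← mapRange_tens, tens_self] at hw
  refine ⟨Finsupp.mapRange.linearMap (faceIdeal 𝒜 h0 hT).mkQ (freeProj 𝒜 (F.deg (i + 1)) j w'),
    fun t => ⟨_, freeProj_mem 𝒜 (F.deg (i + 1)) j w' t, rfl⟩, ?_⟩
  refine (mapRange_tens (faceIdeal 𝒜 h0 hT).mkQ (F.d i)
    (freeProj 𝒜 (F.deg (i + 1)) j w')).symm.trans ?_
  rw [tens_self, ← freeProj_comm 𝒜 (F.d_graded i)]
  ext t
  have h1 : F.d i w' t - z' t ∈ faceIdeal 𝒜 h0 hT :=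
    (Submodule.Quotient.eq _).mp (DFunLike.congr_fun hw t)
  refine (Submodule.Quotient.eq _).mpr ?_
  have h3 : z' t ∈ 𝒜 (j - F.deg i t) := hz' t
  have h2 := proj_mem_faceIdeal 𝒜 h0 hT h1 (j - F.deg i t)
  rwa [map_sub, GradedAlgebra.proj_apply _ _ (z' t), DirectSum.decompose_of_mem_same _ h3,
    ← freeProj_apply] at h2

variable {ω : ι →+ ℤ} (hA : ConnectedBy 𝒜 ω) [Nontrivial A]
    (F : GradedFreeResolution K A 𝒜 (A ⧸ irrelevant 𝒜) (residueGrading K A 𝒜)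
      fun s => {v | ω v = s}) {S : Set ι} (hS : ∀ v ∈ S, ∀ p, p + v ∉ S → 𝒜 p = ⊥)
include hA F hS

theorem exists_resolution_offFace (h0 : T 0)
    (hT : ∀ p q, 𝒜 p = ⊥ ∨ 𝒜 q = ⊥ ∨ (T (p + q) ↔ T p ∧ T q))
    (hTS : ∀ j ∉ S, T j ∨ 𝒜 j = ⊥) :
    Nonempty (HomogeneousResolution 𝒜 A (offFace 𝒜 T) fun s => {v | ω v = 1 + s ∧ v ∈ S}) := by
  obtain ⟨s₀⟩ := hA.nonempty_zero (F.toHomogeneous 𝒜)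
  have hoff : ∀ j, T j ∨ 𝒜 j = ⊥ → offFace 𝒜 T j = ⊥ := by
    intro j hj
    rw [offFace]
    split_ifs with h
    · rfl
    · exact hj.resolve_left h
  have hL : LinearTor (F.toHomogeneous 𝒜) ω S 1 (offFace 𝒜 T) := by
    refine ⟨?_, fun j hj => hoff j ?_, fun j hj => hoff j (hTS j hj), ?_⟩
    · rw [← kerGrading_faceIdeal 𝒜 h0 hT]
      exact (gradedCompat_self 𝒜).ker _
    · by_cases hj0 : j = 0
      · exact Or.inl (hj0 ▸ h0)
      · rcases (show ω j ≤ 0 by lia).lt_or_eq with h | h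
        · exact Or.inr (hA.eq_bot_of_neg _ h)
        · exact Or.inr (hA.eq_bot_of_zero _ h hj0)
    · intro i j hij
      rw [← kerGrading_faceIdeal 𝒜 h0 hT]
      refine HomogeneousResolution.TorVan.ker (𝒩 := faceQuotientGrading 𝒜 h0 hT) _
        (gradedCompat_self 𝒜) (fun j m hm => ⟨m, hm, rfl⟩) (fun j n hn => hn)
        (HomogeneousResolution.torVan_self _ (Or.inr (residueGrading_eq_bot ?_)))
        (torVan_faceQuotientGrading 𝒜 h0 hT F (by push_cast; lia))
      rintro rfl
      rw [map_zero] at hij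
      lia
  exact hL.exists_resolution hA hS
    (fun v hv => residueGrading_eq_bot (by rintro rfl; exact hv (map_zero ω)))
    (fun v hv => by simpa using hv) (fun v (hv : ω v = _) => by simp [hv]) s₀

theorem exists_resolution_residue (hS0 : (0 : ι) ∈ S) :
    Nonempty (HomogeneousResolution 𝒜 (A ⧸ irrelevant 𝒜) (residueGrading K A 𝒜)
      fun s => {v | ω v = 0 + s ∧ v ∈ S}) := by
  obtain ⟨s₀⟩ := hA.nonempty_zero (F.toHomogeneous 𝒜)
  have hL : LinearTor (F.toHomogeneous 𝒜) ω S 0 (residueGrading K A 𝒜) := by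
    refine ⟨gradedCompat_residueGrading, fun j hj => residueGrading_eq_bot ?_,
      fun j hj => residueGrading_eq_bot ?_, fun i j hij => ?_⟩
    · rintro rfl; rw [map_zero] at hj; lia
    · rintro rfl; exact hj hS0
    · refine HomogeneousResolution.torVan_of_eq_bot _ fun s => residueGrading_eq_bot fun h => ?_
      have hs : ω (F.deg i s) = i := F.deg_mem i s
      have := congrArg ω h
      rw [map_sub, map_zero] at this
      have : ω j - ω (F.deg i s) = 0 := this
      lia
  exact hL.exists_resolution hA hS
    (fun v hv => residueGrading_eq_bot (by rintro rfl; exact hv (map_zero ω)))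
    (fun v hv => by simpa using hv) (fun v (hv : ω v = _) => by simp [hv]) s₀

end Face

section Strand

variable {K R B : Type} [Field K] [CommRing R] [Algebra K R] [CommRing B] [Algebra K B]
  [Algebra B R] [IsScalarTower K B R]

/-- The strand of a bigraded module in the direction `(a, b)` through the degree `w`. -/
def strand {M : Type} [AddCommGroup M] [Module K M] (ℳ : ℤ × ℤ → Submodule K M) (a b : ℤ)
    (w : ℤ × ℤ) (j : ℤ) : Submodule K M := ℳ (w.1 + j * a, w.2 + j * b)

variable {ℛ : ℤ × ℤ → Submodule K R} [GradedAlgebra ℛ] {ℬ : ℤ → Submodule K B} [GradedAlgebra ℬ]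
  {a b : ℤ} (hℬ : ∀ j, ∀ y ∈ ℬ j, algebraMap B R y ∈ ℛ (j * a, j * b))
include hℬ

omit [IsScalarTower K B R] [GradedAlgebra ℛ] [GradedAlgebra ℬ] in
theorem gradedCompat_strand {M : Type} [AddCommGroup M] [Module K M] [Module R M] [Module B M]
    [IsScalarTower B R M] {ℳ : ℤ × ℤ → Submodule K M} (hM : GradedCompat ℛ ℳ) (w : ℤ × ℤ) :
    GradedCompat ℬ (strand ℳ a b w) := by
  intro p q x m hx hm
  have := hM _ _ _ _ (hℬ p x hx) hm
  rw [algebraMap_smul] at this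
  have he : ((p * a, p * b) + (w.1 + q * a, w.2 + q * b) : ℤ × ℤ) =
      (w.1 + (p + q) * a, w.2 + (p + q) * b) := by
    ext <;> simp only [Prod.mk_add_mk] <;> ring
  rwa [he] at this

variable {P : Type} [AddCommGroup P] [Module B P] [Module K P] {ℋ : ℤ → Submodule K P}
  {E : ℕ → Set ℤ} (Q : HomogeneousResolution ℬ P ℋ E)

/-- Vanishing of Tor for the strands of a bigraded module, from a bigraded free resolution. -/
theorem torVan_strand {M : Type} [AddCommGroup M] [Module K M] [Module R M] [Module B M]
    [IsScalarTower B R M] {ℳ : ℤ × ℤ → Submodule K M} {D : ℕ → Set (ℤ × ℤ)}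
    (G : HomogeneousResolution ℛ M ℳ D) (w : ℤ × ℤ) {i : ℕ} {j : ℤ}
    (h : ∀ s ≤ i, ∀ v ∈ D s, Q.TorVan (strand ℛ a b (w - v)) (i - s) j) :
    Q.TorVan (strand ℳ a b w) i j := by
  refine HomogeneousResolution.TorVan.of_complex Q (N := fun s => G.σ s →₀ R)
    (𝒩 := fun s => strand (freeGrading ℛ (G.deg s)) a b w)
    (G.aug.restrictScalars B) (fun s => (G.d s).restrictScalars B)
    (fun s => gradedCompat_strand hℬ (gradedCompat_free ℛ _) w)
    (fun j n hn => G.aug_graded _ n hn) (fun s j n hn => G.d_graded s _ n hn)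
    (fun j m hm => G.aug_surj _ m hm) (fun j n _ => LinearMap.congr_fun G.aug_d n)
    (fun s j n _ => LinearMap.congr_fun (G.d_d s) n) (fun j n hn => G.exact_zero _ n hn)
    (fun s j n hn => G.exact_succ s _ n hn) (fun s hs => ?_)
  have he : strand (freeGrading ℛ (G.deg s)) a b w =
      sumGrading fun t => strand ℛ a b (w - G.deg s t) := by
    funext j
    ext f
    refine forall_congr' fun t => ?_
    have : ((w.1 + j * a, w.2 + j * b) - G.deg s t : ℤ × ℤ) =
        ((w - G.deg s t).1 + j * a, (w - G.deg s t).2 + j * b) := by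
      ext <;> simp only [Prod.fst_sub, Prod.snd_sub] <;> ring
    rw [this]
    rfl
  rw [he]
  exact HomogeneousResolution.TorVan.sum Q fun t => h s hs _ (G.deg_mem s t)

omit hℬ [IsScalarTower K B R] [GradedAlgebra ℛ] [GradedAlgebra ℬ] in
theorem torVan_strand_of_shift (hneg : ∀ p : ℤ × ℤ, p.1 < 0 ∨ p.2 < 0 → ℛ p = ⊥) {u : ℤ × ℤ}
    {s i : ℕ} {j : ℤ} (h1 : 0 ≤ u.1 + s * a ∨ a = 0) (h2 : 0 ≤ u.2 + s * b ∨ b = 0)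
    (h : 0 ≤ u.1 + s * a → 0 ≤ u.2 + s * b →
      Q.TorVan (strand ℛ a b (u.1 + s * a, u.2 + s * b)) i (j - s)) :
    Q.TorVan (strand ℛ a b u) i j := by
  by_cases hu : 0 ≤ u.1 + s * a ∧ 0 ≤ u.2 + s * b
  · have he : strand ℛ a b u = fun j => strand ℛ a b (u.1 + s * a, u.2 + s * b) (j - s) := by
      funext j
      simp only [strand]
      congr 1
      ext <;> ring
    rw [he]
    exact (Q.torVan_shift _ _ _ _).mpr (h hu.1 hu.2)
  · refine Q.torVan_of_eq_bot fun t => hneg _ ?_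
    rcases not_and_or.mp hu with hlt | hlt
    · left
      obtain rfl := h1.resolve_left hlt
      simpa using hlt
    · right
      obtain rfl := h2.resolve_left hlt
      simpa using hlt

/-- Strands of a bigraded algebra have linear Tor over the diagonal subalgebra, if the
ideals of elements of positive first (second) degree have linear resolutions. -/
theorem torVan_strand_self {κ : ℤ → Submodule K (B ⧸ irrelevant ℬ)}
    (hκ : ∀ j, j ≠ 0 → κ j = ⊥) (Q : HomogeneousResolution ℬ (B ⧸ irrelevant ℬ) κ E)
    (hℬs : ∀ j, ∀ x ∈ ℛ (j * a, j * b), ∃ y ∈ ℬ j, algebraMap B R y = x)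
    (hinj : Function.Injective (algebraMap B R))
    (ha : 0 ≤ a) (hb : 0 ≤ b) (hab : ¬(a = 0 ∧ b = 0))
    (hneg : ∀ p : ℤ × ℤ, p.1 < 0 ∨ p.2 < 0 → ℛ p = ⊥)
    (G₁ : HomogeneousResolution ℛ R (offFace ℛ fun p => p.1 = 0)
      fun s => {v | v.1 + v.2 = 1 + s ∧ 1 ≤ v.1 ∧ 0 ≤ v.2})
    (G₂ : HomogeneousResolution ℛ R (offFace ℛ fun p => p.2 = 0)
      fun s => {v | v.1 + v.2 = 1 + s ∧ 0 ≤ v.1 ∧ 1 ≤ v.2})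
    (i n : ℕ) (w : ℤ × ℤ) (hw1 : 0 ≤ w.1) (hw2 : 0 ≤ w.2) (hn : (w.1 + w.2).toNat = n)
    (j : ℤ) (hij : i < j) : Q.TorVan (strand ℛ a b w) i j := by
  induction i using Nat.strong_induction_on generalizing n w j with
  | _ i ihi =>
  induction n using Nat.strong_induction_on generalizing w j with
  | _ n ihn =>
  by_cases hw0 : w = 0
  · subst hw0
    refine HomogeneousResolution.TorVan.of_surjective (ℳ := ℬ) Q (gradedCompat_self ℬ)
      (g := Algebra.linearMap B R) (fun j m hm => ?_) (fun j x hx => hℬs j x ?_)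
      (Q.torVan_self (Or.inr (hκ j (by lia)))) (fun k _ => Q.torVan_of_eq_bot fun s => ?_)
    · simpa [strand] using hℬ j m hm
    · simpa [strand] using hx
    · rw [eq_bot_iff]
      intro x hx
      rw [mem_kerGrading] at hx
      exact hinj (hx.2.trans (map_zero _).symm)
  by_cases hwΔ : a ≤ w.1 ∧ b ≤ w.2
  · have he : strand ℛ a b w = fun j => strand ℛ a b (w.1 - a, w.2 - b) (j - (-1)) := by
      funext j
      simp only [strand]
      congr 1
      ext <;> ring
    rw [he]
    exact (Q.torVan_shift _ _ _ _).mpr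
      (ihn _ (by lia) _ (by simp; lia) (by simp; lia) rfl _ (by lia))
  have hbelow : ∀ j, j < 0 → w.1 + j * a < 0 ∨ w.2 + j * b < 0 := by
    intro j hj
    rcases not_and_or.mp hwΔ with h | h
    · left; nlinarith
    · right; nlinarith
  have hterm : ∀ s ≤ i, ∀ v : ℤ × ℤ, v.1 + v.2 = 1 + s →
      (0 ≤ (w - v).1 + s * a ∨ a = 0) → (0 ≤ (w - v).2 + s * b ∨ b = 0) →
      Q.TorVan (strand ℛ a b (w - v)) (i - s) j := by
    intro s hs v hv h1 h2
    refine torVan_strand_of_shift (s := s) Q hneg h1 h2 fun h3 h4 => ?_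
    rcases Nat.eq_zero_or_pos s with rfl | hs0
    · refine ihn _ ?_ _ h3 h4 rfl _ (by simpa using hij)
      simp at h3 h4 hv ⊢
      lia
    · exact ihi (i - s) (by lia) _ _ h3 h4 rfl _ (by lia)
  have hmul : ∀ (s : ℕ) {c : ℤ}, 0 ≤ c → c ≠ 0 → (s : ℤ) ≤ s * c := fun s c h1 h2 =>
    le_mul_of_one_le_right (by lia) (by lia)
  by_cases hw : 1 ≤ w.1
  · have he : strand (offFace ℛ fun p => p.1 = 0) a b w = strand ℛ a b w := by
      funext j
      simp only [strand, offFace]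
      split_ifs with h
      · refine (hneg _ (hbelow j ?_)).symm
        by_contra! hj
        nlinarith
      · rfl
    rw [← he]
    refine torVan_strand hℬ Q G₁ w fun s hs v hv => hterm s hs v hv.1 ?_ ?_
    · by_cases ha0 : a = 0
      · exact Or.inr ha0
      · have := hmul s ha ha0
        obtain ⟨h1, h2, h3⟩ := hv
        left; simp only [Prod.fst_sub]; lia
    · by_cases hb0 : b = 0
      · exact Or.inr hb0
      · have := hmul s hb hb0
        obtain ⟨h1, h2, h3⟩ := hv
        left; simp only [Prod.snd_sub]; lia
  · have hw' : 1 ≤ w.2 := by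
      by_contra h
      exact hw0 (Prod.ext (by simp; lia) (by simp; lia))
    have he : strand (offFace ℛ fun p => p.2 = 0) a b w = strand ℛ a b w := by
      funext j
      simp only [strand, offFace]
      split_ifs with h
      · refine (hneg _ (hbelow j ?_)).symm
        by_contra! hj
        nlinarith
      · rfl
    rw [← he]
    refine torVan_strand hℬ Q G₂ w fun s hs v hv => hterm s hs v hv.1 ?_ ?_
    · by_cases ha0 : a = 0
      · exact Or.inr ha0
      · have := hmul s ha ha0
        obtain ⟨h1, h2, h3⟩ := hv
        left; simp only [Prod.fst_sub]; lia
    · by_cases hb0 : b = 0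
      · exact Or.inr hb0
      · have := hmul s hb hb0
        obtain ⟨h1, h2, h3⟩ := hv
        left; simp only [Prod.snd_sub]; lia

end Strand

section Diagonal

/-- The trivial algebra is Koszul. -/
theorem isKoszul_of_subsingleton {K B : Type} [Field K] [CommRing B] [Algebra K B]
    [Subsingleton B] (ℬ : ℤ → Submodule K B) : IsKoszul K B ℬ := by
  have : Subsingleton (B ⧸ irrelevant ℬ) := Ideal.Quotient.mk_surjective.subsingleton
  exact ⟨{
    σ := fun _ => Empty
    deg := fun _ => Empty.elim
    deg_mem := fun _ i => i.elim
    aug := 0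
    d := fun _ => 0
    aug_surjective := fun y => ⟨0, Subsingleton.elim _ _⟩
    aug_graded := fun _ _ _ => zero_mem _
    d_graded := fun _ _ _ _ => zero_mem _
    exact_zero := Subsingleton.elim _ _
    exact_succ := fun _ => Subsingleton.elim _ _ }⟩

variable {K R : Type} [Field K] [CommRing R] [Algebra K R] {ℛ : ℤ × ℤ → Submodule K R}

/-- The total degree of a bidegree. -/
def totalDegree : ℤ × ℤ →+ ℤ := AddMonoidHom.fst ℤ ℤ + AddMonoidHom.snd ℤ ℤ

theorem totalDegree_apply (p : ℤ × ℤ) : totalDegree p = p.1 + p.2 := rfl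

theorem IsStandardBigraded.connectedBy (h : IsStandardBigraded K R ℛ) :
    ConnectedBy ℛ totalDegree := by
  refine ⟨fun p hp => h.1 p ?_, fun p hp hp0 => h.1 p ?_, fun x hx => ?_⟩
  · rw [totalDegree_apply] at hp; lia
  · rw [totalDegree_apply] at hp
    by_contra! hc
    exact hp0 (Prod.ext (by simp; lia) (by simp; lia))
  · rw [show (0 : ℤ × ℤ) = (0, 0) from rfl, h.2.1, Submodule.mem_one] at hx
    obtain ⟨c, rfl⟩ := hx
    exact ⟨c, rfl⟩

variable [GradedAlgebra ℛ]

theorem diagonal_torVan_residue {B : Type} [CommRing B] [Algebra K B] [Algebra B R]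
    [IsScalarTower K B R] [Nontrivial R] {ℬ : ℤ → Submodule K B} [GradedAlgebra ℬ] {a b : ℤ}
    (hstd : IsStandardBigraded K R ℛ) (hkoszul : IsKoszulBi K R ℛ)
    (ha : 0 ≤ a) (hb : 0 ≤ b) (hab : ¬(a = 0 ∧ b = 0))
    (hℬ : ∀ j, ∀ y ∈ ℬ j, algebraMap B R y ∈ ℛ (j * a, j * b))
    (hℬs : ∀ j, ∀ x ∈ ℛ (j * a, j * b), ∃ y ∈ ℬ j, algebraMap B R y = x)
    (hinj : Function.Injective (algebraMap B R)) {E : ℕ → Set ℤ}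
    (Q : HomogeneousResolution ℬ (B ⧸ irrelevant ℬ) (residueGrading K B ℬ) E)
    {i : ℕ} {j : ℤ} (hij : i < j) : Q.TorVan (residueGrading K B ℬ) i j := by
  have hA := hstd.connectedBy
  obtain ⟨F⟩ := hkoszul
  have hneg := hstd.1
  obtain ⟨G₁⟩ := exists_resolution_offFace ℛ (T := fun p => p.1 = 0) hA F
    (S := {v | 1 ≤ v.1 ∧ 0 ≤ v.2})
    (by
      intro v hv p hp
      refine hneg p ?_
      by_contra! hc
      exact hp ⟨by have := hv.1; simp; lia, by have := hv.2; simp; lia⟩)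
    rfl
    (by
      intro p q
      by_contra! hc
      have h1 : ¬ (p.1 < 0 ∨ p.2 < 0) := fun h => hc.1 (hneg p h)
      have h2 : ¬ (q.1 < 0 ∨ q.2 < 0) := fun h => hc.2.1 (hneg q h)
      have h3 := hc.2.2
      simp only [Prod.fst_add] at h3
      lia)
    (by
      intro j hj
      by_contra! hc
      have h1 : ¬ (j.1 < 0 ∨ j.2 < 0) := fun h => hc.2 (hneg j h)
      have h2 := hc.1
      exact hj ⟨by lia, by lia⟩)
  obtain ⟨G₂⟩ := exists_resolution_offFace ℛ (T := fun p => p.2 = 0) hA F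
    (S := {v | 0 ≤ v.1 ∧ 1 ≤ v.2})
    (by
      intro v hv p hp
      refine hneg p ?_
      by_contra! hc
      exact hp ⟨by have := hv.1; simp; lia, by have := hv.2; simp; lia⟩)
    rfl
    (by
      intro p q
      by_contra! hc
      have h1 : ¬ (p.1 < 0 ∨ p.2 < 0) := fun h => hc.1 (hneg p h)
      have h2 : ¬ (q.1 < 0 ∨ q.2 < 0) := fun h => hc.2.1 (hneg q h)
      have h3 := hc.2.2
      simp only [Prod.snd_add] at h3
      lia)
    (by
      intro j hj
      by_contra! hc
      have h1 : ¬ (j.1 < 0 ∨ j.2 < 0) := fun h => hc.2 (hneg j h)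
      have h2 := hc.1
      exact hj ⟨by lia, by lia⟩)
  obtain ⟨F'⟩ := exists_resolution_residue ℛ hA F (S := {v | 0 ≤ v.1 ∧ 0 ≤ v.2})
    (by
      intro v hv p hp
      refine hneg p ?_
      by_contra! hc
      exact hp ⟨by have := hv.1; simp; lia, by have := hv.2; simp; lia⟩)
    ⟨le_rfl, le_rfl⟩
  have hV := torVan_strand_self hℬ (fun j => residueGrading_eq_bot) Q hℬs hinj ha hb hab hneg
    G₁ G₂
  have hmul : ∀ (s : ℕ) {c : ℤ}, 0 ≤ c → c ≠ 0 → (s : ℤ) ≤ s * c := fun s c h1 h2 =>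
    le_mul_of_one_le_right (by lia) (by lia)
  have hstrand : Q.TorVan (strand (residueGrading K R ℛ) a b 0) i j := by
    refine torVan_strand hℬ Q F' 0 fun s hs v hv => ?_
    obtain ⟨h1, h2, h3⟩ := hv
    rw [totalDegree_apply] at h1
    refine torVan_strand_of_shift (s := s) Q hneg ?_ ?_ fun h4 h5 =>
      hV _ _ _ h4 h5 rfl _ (by lia)
    · by_cases ha0 : a = 0
      · exact Or.inr ha0
      · have := hmul s ha ha0
        left; simp only [Prod.fst_sub, Prod.fst_zero]; lia
    · by_cases hb0 : b = 0
      · exact Or.inr hb0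
      · have := hmul s hb hb0
        left; simp only [Prod.snd_sub, Prod.snd_zero]; lia
  have hdeg : ∀ j : ℤ, (((0 : ℤ × ℤ).1 + j * a, (0 : ℤ × ℤ).2 + j * b) : ℤ × ℤ) =
      (j * a, j * b) := fun j => by simp
  have hle : irrelevant ℬ ≤ LinearMap.ker (Algebra.linearMap B (R ⧸ irrelevant ℛ)) := by
    refine Ideal.span_le.mpr ?_
    rintro y ⟨j, hj, hy⟩
    refine (Ideal.Quotient.eq_zero_iff_mem (I := irrelevant ℛ)).mpr
      (Ideal.subset_span ⟨_, fun h => ?_, hℬ j y hy⟩)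
    have h1 : j * a = 0 := congrArg Prod.fst h
    have h2 : j * b = 0 := congrArg Prod.snd h
    exact hab ⟨(mul_eq_zero.mp h1).resolve_left hj, (mul_eq_zero.mp h2).resolve_left hj⟩
  let g : (B ⧸ irrelevant ℬ) →ₗ[B] (R ⧸ irrelevant ℛ) :=
    Submodule.liftQ (irrelevant ℬ) (Algebra.linearMap B (R ⧸ irrelevant ℛ)) hle
  have hg : ∀ y, g (Ideal.Quotient.mk _ y) = Ideal.Quotient.mk _ (algebraMap B R y) :=
    fun y => rfl
  refine HomogeneousResolution.TorVan.of_bijective Q (g := g)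
    (𝒩 := strand (residueGrading K R ℛ) a b 0) ?_ ?_ ?_
    gradedCompat_residueGrading hstrand
  · intro j m hm
    obtain ⟨y, hy, rfl⟩ := exists_mem_mk_eq hm
    rw [hg, strand, hdeg]
    exact mk_mem_residueGrading (hℬ j y hy)
  · intro j n hn
    rw [strand, hdeg] at hn
    obtain ⟨x, hx, rfl⟩ := exists_mem_mk_eq hn
    obtain ⟨y, hy, rfl⟩ := hℬs j x hx
    exact ⟨_, mk_mem_residueGrading hy, hg y⟩
  · intro j m hm h0
    by_cases hj : j = 0
    · subst hj
      obtain ⟨y, hy, rfl⟩ := exists_mem_mk_eq hm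
      rw [hg, Ideal.Quotient.eq_zero_iff_mem] at h0
      have h1 := hℬ 0 y hy
      rw [zero_mul, zero_mul] at h1
      rw [hinj ((hA.eq_zero_of_mem_irrelevant h0 h1).trans (map_zero _).symm), map_zero]
    · rwa [residueGrading_eq_bot hj, Submodule.mem_bot] at hm

end Diagonal

/-- **Theorem (main result, diagonal case).**  If `R` is a standard bigraded Koszul
`K`-algebra, then every diagonal subalgebra `R_Δ = ⊕_{i ≥ 0} R_{(ia, ib)}`
(for `(a,b) ≠ (0,0)`) is a Koszul algebra.  The diagonal subalgebra is represented by
an arbitrary graded `K`-algebra `B` together with an injective algebra homomorphism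
`φ : B → R` identifying the `i`-th graded component of `B` with `R_{(ia, ib)}`. -/
theorem diagonal_of_koszul_isKoszul
    (K R : Type) [Field K] [CommRing R] [Algebra K R]
    (ℛ : ℤ × ℤ → Submodule K R) [GradedAlgebra ℛ]
    (hstd : IsStandardBigraded K R ℛ)
    (hkoszul : IsKoszulBi K R ℛ)
    (a b : ℤ) (ha : 0 ≤ a) (hb : 0 ≤ b) (hab : ¬(a = 0 ∧ b = 0))
    (B : Type) [CommRing B] [Algebra K B]
    (ℬ : ℤ → Submodule K B) [GradedAlgebra ℬ]
    (φ : B →ₐ[K] R) (hφinj : Function.Injective φ)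
    (hφ : ∀ i : ℤ, Submodule.map φ.toLinearMap (ℬ i) = ℛ (i * a, i * b)) :
    IsKoszul K B ℬ := by
  rcases subsingleton_or_nontrivial B with hB | hB
  · exact isKoszul_of_subsingleton ℬ
  have : Nontrivial R := hφinj.nontrivial
  let : Algebra B R := φ.toRingHom.toAlgebra
  have hmap : ∀ y, algebraMap B R y = φ y := fun _ => rfl
  have : IsScalarTower K B R := IsScalarTower.of_algebraMap_eq fun c => (φ.commutes c).symm
  have hℬ : ∀ j, ∀ y ∈ ℬ j, algebraMap B R y ∈ ℛ (j * a, j * b) := fun j y hy =>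
    hφ j ▸ Submodule.mem_map_of_mem (f := φ.toLinearMap) hy
  have hℬs : ∀ j, ∀ x ∈ ℛ (j * a, j * b), ∃ y ∈ ℬ j, algebraMap B R y = x := by
    intro j x hx
    rw [← hφ j] at hx
    obtain ⟨y, hy, rfl⟩ := hx
    exact ⟨y, hy, rfl⟩
  have hA : ConnectedBy ℬ (AddMonoidHom.id ℤ) := by
    refine ⟨fun p hp => ?_, fun p hp hp0 => absurd hp hp0, fun y hy => ?_⟩
    · rw [eq_bot_iff]
      intro y hy
      have h1 := hℬ p y hy
      rw [hstd.1, Submodule.mem_bot, hmap] at h1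
      · exact hφinj (h1.trans (map_zero φ).symm)
      · have hp : p < 0 := hp
        by_contra! hc
        exact hab ⟨by nlinarith [hc.1], by nlinarith [hc.2]⟩
    · have h1 := hℬ 0 y hy
      rw [zero_mul, zero_mul] at h1
      obtain ⟨c, hc⟩ := hstd.connectedBy.scalar _ h1
      exact ⟨c, hφinj (by rw [φ.commutes]; exact hc)⟩
  obtain ⟨Q⟩ := hA.exists_resolution
  obtain ⟨s₀⟩ := hA.nonempty_zero Q
  have hL : LinearTor Q (AddMonoidHom.id ℤ) Set.univ 0 (residueGrading K B ℬ) :=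
    ⟨gradedCompat_residueGrading, fun j hj => residueGrading_eq_bot (ne_of_lt hj),
      fun j hj => absurd (Set.mem_univ j) hj, fun i j hij =>
        diagonal_torVan_residue hstd hkoszul ha hb hab hℬ hℬs hφinj Q (by simpa using hij)⟩
  obtain ⟨G⟩ := hL.exists_resolution hA (fun _ _ _ h => absurd (Set.mem_univ _) h)
    (fun v hv => residueGrading_eq_bot hv) (fun v hv => by simpa using hv)
    (fun v hv => by simpa using hv) s₀
  let H := G.toGradedFree ℬ
  exact ⟨{ H with deg_mem := fun s t => by simpa using (H.deg_mem s t).1 }⟩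
end

section
/- The algebra R = K[x,y]/(x y²), bigraded with deg x = (1,0) and deg y = (0,1), is not Koszul, but for every pair (a,b) ≠ (0,0) of nonnegative integers the diagonal subalgebra R_Δ = ⊕_{i≥0} R_{(ia,ib)} is Koszul; indeed each R_Δ is isomorphic as a graded K-algebra to K[t], to K, or to K[t]/(t²). -/
open MvPolynomial in
/-- The bigraded components of `R = K[x,y]/(xy²)`, where `deg x = (1,0)` and
`deg y = (0,1)`: the component of bidegree `p` is spanned by the image of the
monomial `x^{p.1} y^{p.2}`. -/
noncomputable def xyGrading (K : Type) [Field K] (p : ℤ × ℤ) :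
    Submodule K (MvPolynomial (Fin 2) K ⧸
      Ideal.span {(X 0 * X 1 ^ 2 : MvPolynomial (Fin 2) K)}) :=
  Submodule.span K {z | ∃ u : Fin 2 →₀ ℕ, (u 0 : ℤ) = p.1 ∧ (u 1 : ℤ) = p.2 ∧
    z = Ideal.Quotient.mk _ (monomial u (1 : K))}

/-- The standard grading of the polynomial ring `K[t]`. -/
noncomputable def polyGrading (K : Type) [Field K] (i : ℤ) : Submodule K (Polynomial K) :=
  if 0 ≤ i then Submodule.span K {Polynomial.X ^ i.toNat} else ⊥

/-- The grading of `K` concentrated in degree `0`. -/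
noncomputable def fieldGrading (K : Type) [Field K] (i : ℤ) : Submodule K K :=
  if i = 0 then ⊤ else ⊥

/-- The standard grading of `K[t]/(t²)`. -/
noncomputable def dualNumbersGrading (K : Type) [Field K] (i : ℤ) :
    Submodule K (Polynomial K ⧸ Ideal.span {(Polynomial.X ^ 2 : Polynomial K)}) :=
  if 0 ≤ i then
    Submodule.span K {Ideal.Quotient.mk _ (Polynomial.X ^ i.toNat)}
  else ⊥

section Koszul

variable {K B : Type} [Field K] [CommRing B] [Algebra K B]

/-- A linear resolution of the residue field whose free modules have rank at most one and whose
differentials are multiplication by `t`; the `s`-th free module is nonzero iff `P s`. -/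
theorem isKoszul_of_cyclic (ℬ : ℤ → Submodule K B) [GradedAlgebra ℬ] {t : B} (ht : t ∈ ℬ 1)
    (P : ℕ → Prop) (hP0 : P 0) (hP : ∀ s, P (s + 1) → P s)
    (hirr : ∀ b, b ∈ irrelevant ℬ ↔ ∃ c, b = t * c ∧ (¬ P 1 → c = 0))
    (hann : ∀ s, P (s + 1) → ∀ b, t * b = 0 ↔ ∃ c, b = t * c ∧ (¬ P (s + 2) → c = 0)) :
    IsKoszul K B ℬ := by
  let f (s : ℕ) : PLift (P (s + 1)) → PLift (P s) := fun p => ⟨hP s p.down⟩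
  let d (s : ℕ) : (PLift (P (s + 1)) →₀ B) →ₗ[B] (PLift (P s) →₀ B) :=
    t • Finsupp.lmapDomain B B (f s)
  have hd (s : ℕ) (g : PLift (P (s + 1)) →₀ B) (p : PLift (P s)) (q : PLift (P (s + 1))) :
      d s g p = t * g q := by
    have : p = f s q := Subsingleton.elim _ _
    simp only [d, LinearMap.smul_apply, Finsupp.lmapDomain_apply, Finsupp.smul_apply, smul_eq_mul]
    rw [this, Finsupp.mapDomain_apply (Function.injective_of_subsingleton _)]
  have hd_empty (s : ℕ) (hs : ¬ P (s + 1)) (g : PLift (P (s + 1)) →₀ B) : g = 0 := by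
    ext q; exact absurd q.down hs
  have hrange (s : ℕ) (hs : P s) (g : PLift (P s) →₀ B) :
      g ∈ LinearMap.range (d s) ↔ ∃ c, g ⟨hs⟩ = t * c ∧ (¬ P (s + 1) → c = 0) := by
    constructor
    · rintro ⟨g, rfl⟩
      by_cases h : P (s + 1)
      · exact ⟨g ⟨h⟩, hd s g _ _, fun h' => absurd h h'⟩
      · exact ⟨0, by simp [hd_empty s h g], fun _ => rfl⟩
    · rintro ⟨c, hc, h0⟩
      by_cases h : P (s + 1)
      · refine ⟨Finsupp.single ⟨h⟩ c, ?_⟩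
        ext p
        rw [hd s _ p ⟨h⟩, Finsupp.single_eq_same, ← hc]
      · refine ⟨0, ?_⟩
        ext p
        rw [map_zero, Finsupp.zero_apply, show p = ⟨hs⟩ from rfl, hc, h0 h, mul_zero]
  let ev : (PLift (P 0) →₀ B) →ₗ[B] B := Finsupp.lapply ⟨hP0⟩
  refine ⟨{
    σ := fun s => PLift (P s)
    deg := fun s _ => s
    deg_mem := fun s _ => rfl
    aug := (irrelevant ℬ).mkQ ∘ₗ ev
    d := d
    aug_surjective := ?_
    aug_graded := ?_
    d_graded := ?_
    exact_zero := ?_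
    exact_succ := ?_ }⟩
  · refine (Submodule.mkQ_surjective _).comp fun b => ⟨Finsupp.single ⟨hP0⟩ b, ?_⟩
    simp [ev]
  · intro j g hg
    have hg0 : g ⟨hP0⟩ ∈ ℬ j := by simpa using hg ⟨hP0⟩
    unfold residueGrading
    split_ifs with hj
    · trivial
    · rw [Submodule.mem_bot, LinearMap.comp_apply, Submodule.mkQ_apply,
        Submodule.Quotient.mk_eq_zero]
      exact Ideal.subset_span ⟨j, hj, hg0⟩
  · intro s j g hg p
    by_cases h : P (s + 1)
    · rw [hd s g p ⟨h⟩]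
      have := SetLike.mul_mem_graded ht (hg ⟨h⟩)
      convert this using 2
      push_cast; ring
    · rw [hd_empty s h g, map_zero]
      exact zero_mem _
  · ext g
    rw [hrange 0 hP0, LinearMap.mem_ker, LinearMap.comp_apply, Submodule.mkQ_apply,
      Submodule.Quotient.mk_eq_zero, hirr]
    rfl
  · intro s
    ext g
    by_cases h : P (s + 1)
    · rw [hrange (s + 1) h, LinearMap.mem_ker, ← hann s h]
      constructor
      · intro h0
        ext p
        rw [hd s g p ⟨h⟩, h0, Finsupp.zero_apply]
      · intro h0
        rw [← hd s g ⟨hP s h⟩ ⟨h⟩, h0, Finsupp.zero_apply]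
    · rw [hd_empty s h g]
      simp only [zero_mem]

open Polynomial in
theorem map_aeval_polyGrading {ℬ : ℤ → Submodule K B} {t : B}
    (hℬ : ∀ n : ℕ, ℬ n = Submodule.span K {t ^ n}) (hneg : ∀ i < 0, ℬ i = ⊥) (i : ℤ) :
    Submodule.map (aeval t).toLinearMap (polyGrading K i) = ℬ i := by
  unfold polyGrading
  split_ifs with hi
  · lift i to ℕ using hi
    simp [Submodule.map_span, hℬ]
  · simp [hneg i (not_le.mp hi)]

open Polynomial in
theorem aeval_surjective_of_graded (ℬ : ℤ → Submodule K B) [GradedAlgebra ℬ] {t : B}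
    (hℬ : ∀ n : ℕ, ℬ n = Submodule.span K {t ^ n}) (hneg : ∀ i < 0, ℬ i = ⊥) :
    Function.Surjective (aeval t : K[X] →ₐ[K] B) := by
  have : LinearMap.range (aeval t : K[X] →ₐ[K] B).toLinearMap = ⊤ := by
    rw [eq_top_iff, ← (DirectSum.Decomposition.isInternal ℬ).submodule_iSup_eq_top]
    refine iSup_le fun i => ?_
    rw [← map_aeval_polyGrading hℬ hneg]
    exact LinearMap.map_le_range
  exact LinearMap.range_eq_top.mp this

theorem irrelevant_eq_span {ℬ : ℤ → Submodule K B} {t : B}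
    (hℬ : ∀ n : ℕ, ℬ n = Submodule.span K {t ^ n}) (hneg : ∀ i < 0, ℬ i = ⊥) :
    irrelevant ℬ = Ideal.span {t} := by
  apply le_antisymm
  · refine Ideal.span_le.mpr ?_
    rintro b ⟨i, hi, hb⟩
    obtain h | h := lt_or_ge i 0
    · rw [hneg i h, Submodule.mem_bot] at hb
      simp [hb]
    · lift i to ℕ using h
      rw [hℬ, Submodule.mem_span_singleton] at hb
      obtain ⟨c, rfl⟩ := hb
      have hi' : i ≠ 0 := by exact_mod_cast hi
      exact Submodule.smul_of_tower_mem _ c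
        (Ideal.mem_span_singleton.mpr (dvd_pow_self t hi'))
  · rw [Ideal.span_singleton_le_iff_mem]
    refine Ideal.subset_span ⟨1, one_ne_zero, ?_⟩
    have := hℬ 1
    rw [Nat.cast_one, pow_one] at this
    rw [this]
    exact Submodule.mem_span_singleton_self t

open Polynomial in
theorem koszul_and_equiv_polynomial (ℬ : ℤ → Submodule K B) [GradedAlgebra ℬ] {t : B}
    (hℬ : ∀ n : ℕ, ℬ n = Submodule.span K {t ^ n}) (hneg : ∀ i < 0, ℬ i = ⊥)
    (hinj : Function.Injective (aeval t : K[X] →ₐ[K] B)) :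
    IsKoszul K B ℬ ∧ ∃ e : B ≃ₐ[K] K[X],
      ∀ i : ℤ, Submodule.map e.toLinearMap (ℬ i) = polyGrading K i := by
  have hsurj := aeval_surjective_of_graded ℬ hℬ hneg
  have ht : t ∈ ℬ 1 := by
    have := hℬ 1
    rw [Nat.cast_one, pow_one] at this
    rw [this]
    exact Submodule.mem_span_singleton_self t
  constructor
  · refine isKoszul_of_cyclic ℬ ht (fun s => s < 2) (by norm_num) (fun s h => by omega) ?_ ?_
    · intro b
      rw [irrelevant_eq_span hℬ hneg, Ideal.mem_span_singleton]
      simp [dvd_def]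
    · intro s _ b
      have hs : ¬ s + 2 < 2 := by omega
      constructor
      · intro h
        refine ⟨0, ?_, fun _ => rfl⟩
        obtain ⟨p, rfl⟩ := hsurj b
        have h' : aeval t (X * p) = aeval t (0 : K[X]) := by simpa using h
        have := hinj h'
        rw [mul_eq_zero, or_iff_right X_ne_zero] at this
        simp [this]
      · rintro ⟨c, rfl, hc⟩
        simp [hc hs]
  · let e := AlgEquiv.ofBijective (aeval t : K[X] →ₐ[K] B) ⟨hinj, hsurj⟩
    refine ⟨e.symm, fun i => ?_⟩
    rw [← map_aeval_polyGrading hℬ hneg i, ← Submodule.map_comp]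
    convert Submodule.map_id _
    exact LinearMap.ext fun p => e.symm_apply_apply p

theorem koszul_and_equiv_field [Nontrivial B] (ℬ : ℤ → Submodule K B) [GradedAlgebra ℬ]
    (hℬ : ∀ n : ℕ, ℬ n = Submodule.span K {(0 : B) ^ n}) (hneg : ∀ i < 0, ℬ i = ⊥) :
    IsKoszul K B ℬ ∧ ∃ e : B ≃ₐ[K] K,
      ∀ i : ℤ, Submodule.map e.toLinearMap (ℬ i) = fieldGrading K i := by
  constructor
  · refine isKoszul_of_cyclic ℬ (zero_mem _) (fun s => s < 1) (by norm_num) (fun s h => by omega)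
      ?_ ?_
    · intro b
      rw [irrelevant_eq_span hℬ hneg, Ideal.mem_span_singleton]
      simp
    · intro s hs
      omega
  · have hsurj : Function.Surjective (Algebra.ofId K B) := by
      intro b
      obtain ⟨p, rfl⟩ := aeval_surjective_of_graded ℬ hℬ hneg b
      exact ⟨p.coeff 0, by rw [Polynomial.aeval_def, Polynomial.eval₂_at_zero]; rfl⟩
    let e := AlgEquiv.ofBijective (Algebra.ofId K B) ⟨(algebraMap K B).injective, hsurj⟩
    refine ⟨e.symm, fun i => ?_⟩
    unfold fieldGrading
    split_ifs with hi
    · subst hi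
      have h0 := hℬ 0
      rw [Nat.cast_zero, pow_zero] at h0
      rw [h0, Submodule.map_span, Set.image_singleton]
      simp
    · obtain h | h := lt_or_ge i 0
      · simp [hneg i h]
      · lift i to ℕ using h
        have hi' : i ≠ 0 := by exact_mod_cast hi
        simp [hℬ, hi']

open Polynomial in
theorem koszul_and_equiv_dualNumbers (ℬ : ℤ → Submodule K B) [GradedAlgebra ℬ] {t : B}
    (hℬ : ∀ n : ℕ, ℬ n = Submodule.span K {t ^ n}) (hneg : ∀ i < 0, ℬ i = ⊥)
    (ht0 : t ≠ 0) (ht2 : t ^ 2 = 0) :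
    IsKoszul K B ℬ ∧ ∃ e : B ≃ₐ[K] (K[X] ⧸ Ideal.span {(X ^ 2 : K[X])}),
      ∀ i : ℤ, Submodule.map e.toLinearMap (ℬ i) = dualNumbersGrading K i := by
  have hsurj := aeval_surjective_of_graded ℬ hℬ hneg
  have ht : t ∈ ℬ 1 := by
    have := hℬ 1
    rw [Nat.cast_one, pow_one] at this
    rw [this]
    exact Submodule.mem_span_singleton_self t
  have hcoeff (p : K[X]) (h : t * aeval t p = 0) : p.coeff 0 = 0 := by
    have h1 : aeval t p = t * aeval t p.divX + algebraMap K B (p.coeff 0) := by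
      have := congrArg (aeval t) (divX_mul_X_add p)
      rw [map_add, map_mul, aeval_X, aeval_C, mul_comm] at this
      exact this.symm
    rw [h1, mul_add, ← mul_assoc, ← pow_two, ht2, zero_mul, zero_add, mul_comm,
      ← Algebra.smul_def, smul_eq_zero] at h
    exact h.resolve_right ht0
  constructor
  · refine isKoszul_of_cyclic ℬ ht (fun _ => True) trivial (fun _ _ => trivial) ?_ ?_
    · intro b
      rw [irrelevant_eq_span hℬ hneg, Ideal.mem_span_singleton]
      simp [dvd_def]
    · intro s _ b
      constructor
      · intro h
        obtain ⟨p, rfl⟩ := hsurj b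
        obtain ⟨q, rfl⟩ := X_dvd_iff.mpr (hcoeff p h)
        exact ⟨aeval t q, by simp, by simp⟩
      · rintro ⟨c, rfl, -⟩
        rw [← mul_assoc, ← pow_two, ht2, zero_mul]
  · have hker (p : K[X]) (h : aeval t p = 0) : X ^ 2 ∣ p := by
      obtain ⟨q, rfl⟩ := X_dvd_iff.mpr (hcoeff p (by simp [h]))
      obtain ⟨r, rfl⟩ := X_dvd_iff.mpr (hcoeff q (by simpa using h))
      exact ⟨r, by ring⟩
    have hle : ∀ p : K[X], p ∈ Ideal.span {(X ^ 2 : K[X])} → aeval t p = 0 := by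
      intro p hp
      obtain ⟨q, rfl⟩ := Ideal.mem_span_singleton.mp hp
      simp [ht2]
    let ψ := Ideal.Quotient.liftₐ (Ideal.span {(X ^ 2 : K[X])}) (aeval t) hle
    have hψ (p : K[X]) : ψ (Ideal.Quotient.mk _ p) = aeval t p := rfl
    have hψi : Function.Injective ψ := by
      rw [injective_iff_map_eq_zero]
      intro z hz
      obtain ⟨p, rfl⟩ := Ideal.Quotient.mk_surjective z
      rw [Ideal.Quotient.eq_zero_iff_mem, Ideal.mem_span_singleton]
      exact hker p hz
    have hψs : Function.Surjective ψ := fun b => by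
      obtain ⟨p, rfl⟩ := hsurj b
      exact ⟨Ideal.Quotient.mk _ p, hψ p⟩
    let e := AlgEquiv.ofBijective ψ ⟨hψi, hψs⟩
    refine ⟨e.symm, fun i => ?_⟩
    unfold dualNumbersGrading
    split_ifs with hi
    · lift i to ℕ using hi
      rw [hℬ, Submodule.map_span, Set.image_singleton]
      congr 2
      refine e.symm_apply_eq.mpr ?_
      rw [show ⇑e = ⇑ψ from AlgEquiv.coe_ofBijective _ _, hψ]
      simp
    · simp [hneg i (not_le.mp hi)]

end Koszul

section Lifting

/-- A finitely supported function into the image of an additive subgroup lifts. -/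
theorem exists_mapRange_eq {S R σ F : Type} [AddCommGroup S] [AddCommGroup R] [FunLike F S R]
    [AddMonoidHomClass F S R] (q : F) (M : AddSubgroup S) (w : σ →₀ R)
    (hw : ∀ i, ∃ p ∈ M, q p = w i) :
    ∃ v : σ →₀ S, (∀ i, v i ∈ M) ∧ ∀ i, q (v i) = w i := by
  classical
  choose p hpM hp using hw
  refine ⟨Finsupp.onFinset w.support (fun i => if w i = 0 then 0 else p i) ?_, fun i => ?_,
    fun i => ?_⟩
  · intro i hi
    rw [Finsupp.mem_support_iff]
    intro h
    simp [h] at hi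
  · rw [Finsupp.onFinset_apply]
    split_ifs
    · exact zero_mem _
    · exact hpM i
  · rw [Finsupp.onFinset_apply]
    split_ifs with h
    · rw [h, map_zero]
    · exact hp i

theorem apply_linearMap_finsupp {S σ τ : Type} [CommRing S] (D : (σ →₀ S) →ₗ[S] (τ →₀ S))
    (f : σ →₀ S) (i : τ) : D f i = f.sum fun s c => c * D (Finsupp.single s 1) i := by
  conv_lhs => rw [← Finsupp.sum_single f, map_finsuppSum, Finsupp.sum_apply]
  refine Finsupp.sum_congr fun s _ => ?_
  rw [← smul_eq_mul, ← Finsupp.smul_apply, ← map_smul, Finsupp.smul_single, smul_eq_mul, mul_one]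

open MvPolynomial

variable {K R σ τ : Type} [Field K] [CommRing R]

/-- A linear map between free modules over a quotient `R` of a polynomial ring lifts
to the polynomial ring with prescribed degree of its matrix entries. -/
theorem exists_homogeneous_lift (q : MvPolynomial (Fin 2) K →+* R) (n : ℕ)
    (d : (σ →₀ R) →ₗ[R] (τ →₀ R))
    (hd : ∀ s i, ∃ p : MvPolynomial (Fin 2) K, p.IsHomogeneous n ∧
      q p = d (Finsupp.single s 1) i) :
    ∃ D : (σ →₀ MvPolynomial (Fin 2) K) →ₗ[MvPolynomial (Fin 2) K]
        (τ →₀ MvPolynomial (Fin 2) K),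
      (∀ s i, (D (Finsupp.single s 1) i).IsHomogeneous n) ∧
      ∀ f i, q (D f i) = d (Finsupp.mapRange q (map_zero q) f) i := by
  choose v hv hq using fun s => exists_mapRange_eq q (homogeneousSubmodule (Fin 2) K n).toAddSubgroup
    (d (Finsupp.single s 1)) (hd s)
  refine ⟨Finsupp.linearCombination _ v, fun s i => ?_, fun f i => ?_⟩
  · rw [Finsupp.linearCombination_single, one_smul]
    exact hv s i
  · induction f using Finsupp.induction_linear with
    | zero => simp
    | add f g hf hg =>
      rw [map_add, Finsupp.add_apply, map_add, hf, hg,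
        Finsupp.mapRange_add (map_add q), map_add, Finsupp.add_apply]
    | single s c =>
      rw [Finsupp.linearCombination_single, Finsupp.smul_apply, smul_eq_mul, map_mul, hq,
        Finsupp.mapRange_single, ← smul_eq_mul, ← Finsupp.smul_apply, ← map_smul,
        Finsupp.smul_single, smul_eq_mul, mul_one]

end Lifting

section XYSquared

open MvPolynomial

variable (K : Type) [Field K]

/-- The ideal `(xy²)` of `K[x,y]`. -/
noncomputable abbrev xyIdeal : Ideal (MvPolynomial (Fin 2) K) := Ideal.span {X 0 * X 1 ^ 2}

theorem xyGrading_le_homogeneous {p : ℤ × ℤ} {n : ℕ} (hp : p.1 + p.2 = n)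
    {z : MvPolynomial (Fin 2) K ⧸ xyIdeal K} (hz : z ∈ xyGrading K p) :
    ∃ f : MvPolynomial (Fin 2) K, f.IsHomogeneous n ∧ Ideal.Quotient.mk (xyIdeal K) f = z := by
  have : xyGrading K p ≤ (homogeneousSubmodule (Fin 2) K n).map
      (Ideal.Quotient.mkₐ K (xyIdeal K)).toLinearMap := by
    refine Submodule.span_le.mpr ?_
    rintro z ⟨u, h0, h1, rfl⟩
    refine ⟨monomial u 1, ?_, rfl⟩
    refine isHomogeneous_monomial _ ?_
    rw [Finsupp.degree_eq_sum, Fin.sum_univ_two]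
    omega
  exact this hz

theorem one_mem_xyGrading : (1 : MvPolynomial (Fin 2) K ⧸ xyIdeal K) ∈ xyGrading K 0 :=
  Submodule.subset_span ⟨0, rfl, rfl, rfl⟩

theorem mk_X_mem_irrelevant :
    Ideal.Quotient.mk (xyIdeal K) (X 0) ∈ irrelevant (xyGrading K) := by
  refine Ideal.subset_span ⟨(1, 0), by simp, Submodule.subset_span ?_⟩
  exact ⟨Finsupp.single 0 1, by simp, by simp, rfl⟩

theorem one_notMem_irrelevant : 1 ∉ irrelevant (xyGrading K) := by
  let ε : (MvPolynomial (Fin 2) K ⧸ xyIdeal K) →ₐ[K] K :=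
    Ideal.Quotient.liftₐ (xyIdeal K) (aeval 0) fun p hp => by
      obtain ⟨q, rfl⟩ := Ideal.mem_span_singleton.mp hp
      simp
  have hle : irrelevant (xyGrading K) ≤ RingHom.ker ε := by
    refine Ideal.span_le.mpr ?_
    rintro z ⟨p, hp, hz⟩
    have : xyGrading K p ≤ LinearMap.ker ε.toLinearMap := by
      refine Submodule.span_le.mpr ?_
      rintro z ⟨u, h0, h1, rfl⟩
      change aeval (0 : Fin 2 → K) (monomial u (1 : K)) = 0
      have hu : u ≠ 0 := by
        rintro rfl
        exact hp (Prod.ext (by simpa using h0.symm) (by simpa using h1.symm))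
      obtain ⟨i, hi⟩ := Finsupp.ne_iff.mp hu
      rw [aeval_monomial, Finsupp.prod,
        Finset.prod_eq_zero (Finsupp.mem_support_iff.mpr hi) (by simpa using hi), mul_zero]
    exact this hz
  intro h
  have := hle h
  rw [RingHom.mem_ker, map_one] at this
  exact one_ne_zero this

theorem eq_zero_of_mem_xyIdeal {f : MvPolynomial (Fin 2) K} (hf : f.IsHomogeneous 2)
    (h : f ∈ xyIdeal K) : f = 0 := by
  by_contra hne
  obtain ⟨g, rfl⟩ := Ideal.mem_span_singleton.mp h
  have hg : g ≠ 0 := right_ne_zero_of_mul hne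
  have h3 : (X 0 * X 1 ^ 2 : MvPolynomial (Fin 2) K).totalDegree = 3 :=
    (((isHomogeneous_X K 0).mul ((isHomogeneous_X K 1).pow 2))).totalDegree
      (left_ne_zero_of_mul hne)
  have := hf.totalDegree hne
  rw [totalDegree_mul_of_isDomain (left_ne_zero_of_mul hne) hg, h3] at this
  omega

theorem not_isKoszulBi_xyGrading :
    ¬ IsKoszulBi K (MvPolynomial (Fin 2) K ⧸ xyIdeal K) (xyGrading K) := by
  rintro ⟨F⟩
  let q := Ideal.Quotient.mk (xyIdeal K)
  let qF {σ : Type} (f : σ →₀ MvPolynomial (Fin 2) K) := Finsupp.mapRange q (map_zero q) f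
  have hlin (s : ℕ) (r : F.σ (s + 1)) (i : F.σ s) : ∃ p : MvPolynomial (Fin 2) K,
      p.IsHomogeneous 1 ∧ q p = F.d s (Finsupp.single r 1) i := by
    have hr := F.deg_mem (s + 1) r
    have hi := F.deg_mem s i
    simp only [Set.mem_ofPred_eq] at hr hi
    refine xyGrading_le_homogeneous K (p := F.deg (s + 1) r - F.deg s i) ?_
      (F.d_graded s (F.deg (s + 1) r) (Finsupp.single r 1) (fun j => ?_) i)
    · rw [Prod.fst_sub, Prod.snd_sub]
      push_cast at hr ⊢
      linarith
    · classical
      rw [Finsupp.single_apply]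
      split_ifs with h
      · rw [← h, sub_self]
        exact one_mem_xyGrading K
      · exact zero_mem _
  obtain ⟨D₀, hD₀, hq₀⟩ := exists_homogeneous_lift q 1 (F.d 0) (hlin 0)
  obtain ⟨D₁, hD₁, hq₁⟩ := exists_homogeneous_lift q 1 (F.d 1) (hlin 1)
  have hd (f) : F.d 0 (F.d 1 f) = 0 := by
    have : F.d 1 f ∈ LinearMap.ker (F.d 0) := F.exact_succ 0 ▸ ⟨f, rfl⟩
    exact this
  have hq₁' (f) : qF (D₁ f) = F.d 1 (qF f) := Finsupp.ext fun i => hq₁ f i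
  have hcomp : D₀ ∘ₗ D₁ = 0 := by
    refine Finsupp.lhom_ext' fun r => LinearMap.ext_ring (Finsupp.ext fun i => ?_)
    refine eq_zero_of_mem_xyIdeal K ?_ ?_
    · change (D₀ (D₁ (Finsupp.single r 1)) i).IsHomogeneous 2
      rw [apply_linearMap_finsupp]
      exact IsHomogeneous.sum _ _ _ fun s _ => (hD₁ r s).mul (hD₀ s i)
    · refine Ideal.Quotient.eq_zero_iff_mem.mp ?_
      change q (D₀ (D₁ (Finsupp.single r 1)) i) = 0
      rw [hq₀]
      change F.d 0 (qF (D₁ _)) i = 0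
      rw [hq₁', hd, Finsupp.zero_apply]
  have hD₀' (f i) : constantCoeff (D₀ f i) = 0 := by
    rw [apply_linearMap_finsupp, Finsupp.sum, map_sum]
    refine Finset.sum_eq_zero fun s _ => ?_
    rw [map_mul, constantCoeff_eq, (hD₀ s i).coeff_eq_zero (by simp), mul_zero]
  have hlift {σ : Type} (w : σ →₀ MvPolynomial (Fin 2) K ⧸ xyIdeal K) : ∃ v, qF v = w :=
    Finsupp.mapRange_surjective q (map_zero q) Ideal.Quotient.mk_surjective w
  obtain ⟨i⟩ : Nonempty (F.σ 0) := by
    by_contra hempty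
    rw [not_nonempty_iff] at hempty
    obtain ⟨f, hf⟩ := F.aug_surjective (Submodule.Quotient.mk 1)
    rw [Subsingleton.elim f 0, map_zero, eq_comm, Submodule.Quotient.mk_eq_zero] at hf
    exact one_notMem_irrelevant K hf
  have hx : Finsupp.single i (q (X 0)) ∈ LinearMap.range (F.d 0) := by
    rw [F.exact_zero, LinearMap.mem_ker, ← mul_one (q (X 0)), ← smul_eq_mul,
      ← Finsupp.smul_single, map_smul]
    obtain ⟨z, hz⟩ := Submodule.Quotient.mk_surjective _ (F.aug (Finsupp.single i 1))
    rw [← hz, ← Submodule.Quotient.mk_smul, Submodule.Quotient.mk_eq_zero]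
    exact Ideal.mul_mem_right _ _ (mk_X_mem_irrelevant K)
  obtain ⟨g, hg⟩ := hx
  obtain ⟨G, rfl⟩ := hlift g
  have hy : qF ((X 1 ^ 2 : MvPolynomial (Fin 2) K) • G) ∈ LinearMap.range (F.d 1) := by
    rw [F.exact_succ 0, LinearMap.mem_ker]
    have : qF ((X 1 ^ 2 : MvPolynomial (Fin 2) K) • G) = q (X 1 ^ 2) • qF G :=
      Finsupp.ext fun j => by simp [qF]
    rw [this, map_smul, hg, Finsupp.smul_single, smul_eq_mul, ← map_mul,
      Ideal.Quotient.eq_zero_iff_mem.mpr, Finsupp.single_zero]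
    rw [mul_comm]
    exact Ideal.mem_span_singleton_self _
  obtain ⟨w, hw⟩ := hy
  obtain ⟨W, rfl⟩ := hlift w
  obtain ⟨H, -, hH⟩ := exists_mapRange_eq
    (AddMonoidHom.mulLeft (X 0 * X 1 ^ 2 : MvPolynomial (Fin 2) K)) ⊤
    ((X 1 ^ 2 : MvPolynomial (Fin 2) K) • G - D₁ W) (fun j => by
      have hj := DFunLike.congr_fun hw j
      rw [← hq₁'] at hj
      simp only [qF, Finsupp.mapRange_apply] at hj
      obtain ⟨c, hc⟩ := Ideal.mem_span_singleton.mp (Ideal.Quotient.eq.mp hj.symm)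
      exact ⟨c, trivial, hc.symm⟩)
  have hH' : (X 1 ^ 2 : MvPolynomial (Fin 2) K) • G - D₁ W =
      (X 0 * X 1 ^ 2 : MvPolynomial (Fin 2) K) • H :=
    Finsupp.ext fun j => (hH j).symm
  have key := congrArg (fun v => D₀ v i) hH'
  simp only [map_sub, map_smul, Finsupp.sub_apply, Finsupp.smul_apply, smul_eq_mul] at key
  rw [show D₀ (D₁ W) = 0 from LinearMap.congr_fun hcomp W, Finsupp.zero_apply, sub_zero] at key
  have hG : D₀ G i - X 0 ∈ xyIdeal K := by
    refine Ideal.Quotient.eq.mp ?_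
    have := DFunLike.congr_fun hg i
    rw [Finsupp.single_eq_same] at this
    exact (hq₀ G i).trans this
  obtain ⟨c, hc⟩ := Ideal.mem_span_singleton.mp hG
  rw [sub_eq_iff_eq_add.mp hc] at key
  have key' : (X 0 * X 1 ^ 2 : MvPolynomial (Fin 2) K) * (X 1 ^ 2 * c + 1) =
      X 0 * X 1 ^ 2 * D₀ H i := by
    rw [← key]; ring
  have hne : (X 0 * X 1 ^ 2 : MvPolynomial (Fin 2) K) ≠ 0 :=
    mul_ne_zero (X_ne_zero 0) (pow_ne_zero 2 (X_ne_zero 1))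
  have := congrArg constantCoeff (mul_left_cancel₀ hne key')
  rw [hD₀'] at this
  simp at this

variable {K}

theorem xyGrading_nsmul (a b n : ℕ) :
    xyGrading K (n * a, n * b) =
      Submodule.span K {Ideal.Quotient.mk (xyIdeal K) (X 0 ^ a * X 1 ^ b) ^ n} := by
  unfold xyGrading
  congr 1
  ext z
  simp only [Set.mem_ofPred_eq, Set.mem_singleton_iff]
  have hu (u : Fin 2 →₀ ℕ) (h0 : u 0 = n * a) (h1 : u 1 = n * b) :
      monomial u (1 : K) = (X 0 ^ a * X 1 ^ b) ^ n := by
    rw [monomial_eq, Finsupp.prod_fintype _ _ (by simp), Fin.prod_univ_two, h0, h1, C_1]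
    ring
  constructor
  · rintro ⟨u, h0, h1, rfl⟩
    rw [← map_pow, hu u (by exact_mod_cast h0) (by exact_mod_cast h1)]
  · rintro rfl
    refine ⟨Finsupp.equivFunOnFinite.symm ![n * a, n * b], by simp, by simp, ?_⟩
    rw [← map_pow, hu _ (by simp) (by simp)]

theorem xyGrading_of_neg {p : ℤ × ℤ} (hp : p.1 < 0 ∨ p.2 < 0) : xyGrading K p = ⊥ := by
  refine Submodule.span_eq_bot.mpr ?_
  rintro z ⟨u, h0, h1, rfl⟩
  omega

theorem exists_generator {B : Type} [CommRing B] [Algebra K B] {ℬ : ℤ → Submodule K B}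
    {a b : ℕ} (hab : ¬ (a = 0 ∧ b = 0))
    {φ : B →ₐ[K] (MvPolynomial (Fin 2) K ⧸ xyIdeal K)} (hφ : Function.Injective φ)
    (hmap : ∀ i : ℤ, Submodule.map φ.toLinearMap (ℬ i) = xyGrading K (i * a, i * b)) :
    ∃ t : B, φ t = Ideal.Quotient.mk (xyIdeal K) (X 0 ^ a * X 1 ^ b) ∧
      (∀ n : ℕ, ℬ n = Submodule.span K {t ^ n}) ∧ ∀ i < 0, ℬ i = ⊥ := by
  have hinj := Submodule.map_injective_of_injective (f := φ.toLinearMap) hφ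
  have h1 := hmap (1 : ℕ)
  rw [xyGrading_nsmul, pow_one] at h1
  obtain ⟨t, -, ht⟩ := h1.ge (Submodule.mem_span_singleton_self _)
  replace ht : φ t = Ideal.Quotient.mk (xyIdeal K) (X 0 ^ a * X 1 ^ b) := ht
  refine ⟨t, ht, fun n => hinj ?_, fun i hi => hinj ?_⟩
  · rw [hmap, xyGrading_nsmul, Submodule.map_span, Set.image_singleton]
    simp [ht]
  · rw [hmap, Submodule.map_bot]
    refine xyGrading_of_neg ?_
    rcases Nat.eq_zero_or_pos a with ha | ha
    · right
      exact mul_neg_of_neg_of_pos hi (by omega)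
    · left
      exact mul_neg_of_neg_of_pos hi (by omega)

/-- Over a ring with a point `v` satisfying `xy² = 0`, evaluation at the image of a monomial `m`
is injective as soon as evaluation at `m v` is. -/
theorem aeval_injective_of_point {B C : Type} [CommRing B] [Algebra K B] [CommRing C] [Algebra K C]
    {φ : B →ₐ[K] (MvPolynomial (Fin 2) K ⧸ xyIdeal K)} {t : B} {m : MvPolynomial (Fin 2) K}
    (ht : φ t = Ideal.Quotient.mk (xyIdeal K) m) (v : Fin 2 → C) (hv : v 0 * v 1 ^ 2 = 0)
    (hinj : Function.Injective (Polynomial.aeval (R := K) (aeval v m))) :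
    Function.Injective (Polynomial.aeval (R := K) t) := by
  let θ : (MvPolynomial (Fin 2) K ⧸ xyIdeal K) →ₐ[K] C :=
    Ideal.Quotient.liftₐ (xyIdeal K) (aeval v) fun p hp => by
      obtain ⟨q, rfl⟩ := Ideal.mem_span_singleton.mp hp
      simp [hv]
  have hθ : (θ.comp φ) t = aeval v m := by
    rw [AlgHom.comp_apply, ht]
    rfl
  rw [← hθ] at hinj
  refine Function.Injective.of_comp (f := θ.comp φ) ?_
  convert hinj using 1
  ext p
  exact (Polynomial.aeval_algHom_apply (θ.comp φ) t p).symm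

theorem aeval_X_pow_injective {n : ℕ} (hn : n ≠ 0) :
    Function.Injective (Polynomial.aeval (R := K) (Polynomial.X ^ n : Polynomial K)) := by
  have := Polynomial.expand_injective (R := K) (Nat.pos_of_ne_zero hn)
  exact this

theorem X_pow_mul_X_notMem_xyIdeal (a : ℕ) :
    (X 0 ^ a * X 1 : MvPolynomial (Fin 2) K) ∉ xyIdeal K := by
  intro h
  obtain ⟨q, hq⟩ := Ideal.mem_span_singleton.mp h
  have := congrArg (aeval ![(1 : DualNumber K), DualNumber.eps]) hq
  simp [pow_two] at this
  simpa using congrArg TrivSqZeroExt.snd this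

end XYSquared

/-- **Example.**  The bigraded algebra `R = K[x,y]/(xy²)` (with `deg x = (1,0)`,
`deg y = (0,1)`) is not Koszul, since its defining ideal is generated in degree `3`;
but for every `(a,b) ≠ (0,0)` the diagonal subalgebra `R_Δ = ⊕_{i≥0} R_{(ia, ib)}`
is Koszul — indeed each `R_Δ` is isomorphic, as a graded `K`-algebra, to `K[t]`,
to `K`, or to the Koszul algebra `K[t]/(t²)`. -/
theorem xy_squared_not_koszul_but_diagonals_koszul (K : Type) [Field K] :
    ¬ IsKoszulBi K (MvPolynomial (Fin 2) K ⧸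
        Ideal.span {(MvPolynomial.X 0 * MvPolynomial.X 1 ^ 2 : MvPolynomial (Fin 2) K)})
      (xyGrading K) ∧
    (∀ (a b : ℤ), 0 ≤ a → 0 ≤ b → ¬(a = 0 ∧ b = 0) →
      ∀ (B : Type) [CommRing B] [Algebra K B]
        (ℬ : ℤ → Submodule K B) [GradedAlgebra ℬ]
        (φ : B →ₐ[K] (MvPolynomial (Fin 2) K ⧸
          Ideal.span {(MvPolynomial.X 0 * MvPolynomial.X 1 ^ 2 :
            MvPolynomial (Fin 2) K)})),
        Function.Injective φ →
        (∀ i : ℤ, Submodule.map φ.toLinearMap (ℬ i) = xyGrading K (i * a, i * b)) →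
        IsKoszul K B ℬ ∧
          ((∃ e : B ≃ₐ[K] Polynomial K,
              ∀ i : ℤ, Submodule.map e.toLinearMap (ℬ i) = polyGrading K i) ∨
           (∃ e : B ≃ₐ[K] K,
              ∀ i : ℤ, Submodule.map e.toLinearMap (ℬ i) = fieldGrading K i) ∨
           (∃ e : B ≃ₐ[K] (Polynomial K ⧸
                Ideal.span {(Polynomial.X ^ 2 : Polynomial K)}),
              ∀ i : ℤ, Submodule.map e.toLinearMap (ℬ i) = dualNumbersGrading K i))) := by
  refine ⟨not_isKoszulBi_xyGrading K, fun a b ha hb hab B _ _ ℬ _ φ hφ hmap => ?_⟩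
  lift a to ℕ using ha
  lift b to ℕ using hb
  replace hab : ¬ (a = 0 ∧ b = 0) := by exact_mod_cast hab
  obtain ⟨t, ht, hℬ, hneg⟩ := exists_generator hab hφ hmap
  by_cases hb0 : b = 0
  · subst hb0
    have ha0 : a ≠ 0 := fun h => hab ⟨h, rfl⟩
    refine (koszul_and_equiv_polynomial ℬ hℬ hneg ?_).imp_right Or.inl
    refine aeval_injective_of_point ht ![(Polynomial.X : Polynomial K), 0] (by simp) ?_
    simpa using aeval_X_pow_injective ha0
  by_cases ha0 : a = 0
  · subst ha0
    refine (koszul_and_equiv_polynomial ℬ hℬ hneg ?_).imp_right Or.inl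
    refine aeval_injective_of_point ht ![0, (Polynomial.X : Polynomial K)] (by simp) ?_
    simpa using aeval_X_pow_injective hb0
  have hdvd {n : ℕ} (hn : n ≠ 0) (hbn : 2 ≤ b * n) : t ^ n = 0 := by
    apply hφ
    rw [map_pow, ht, map_zero, ← map_pow, Ideal.Quotient.eq_zero_iff_mem,
      Ideal.mem_span_singleton, mul_pow, ← pow_mul, ← pow_mul]
    exact mul_dvd_mul (dvd_pow_self _ (mul_ne_zero ha0 hn)) (pow_dvd_pow _ hbn)
  by_cases hb1 : b = 1
  · subst hb1
    refine (koszul_and_equiv_dualNumbers ℬ hℬ hneg ?_ (hdvd two_ne_zero le_rfl)).imp_right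
      fun h => Or.inr (Or.inr h)
    rintro rfl
    rw [map_zero, pow_one, eq_comm, Ideal.Quotient.eq_zero_iff_mem] at ht
    exact X_pow_mul_X_notMem_xyIdeal a ht
  · have ht0 : t = 0 := by simpa using hdvd one_ne_zero (by omega)
    subst ht0
    have : Nontrivial B := by
      have hone : (MvPolynomial.X 0 ^ 0 * MvPolynomial.X 1 : MvPolynomial (Fin 2) K) ∉ xyIdeal K :=
        X_pow_mul_X_notMem_xyIdeal 0
      refine ⟨1, 0, fun h => hone ?_⟩
      have h1 := congrArg φ h
      rw [map_one, map_zero, ← map_one (Ideal.Quotient.mk _), Ideal.Quotient.eq_zero_iff_mem] at h1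
      exact (Ideal.eq_top_iff_one (xyIdeal K)).mpr h1 ▸ Submodule.mem_top
    exact (koszul_and_equiv_field ℬ hℬ hneg).imp_right fun h => Or.inr (Or.inl h)
end
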